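/- Let N = 2 and Ω = B(R) ⊂ ℝ² or Ω = ℝ², and let u be a radially symmetric classical solution of u_t = Δu + e^u on Ω × (0,T) (with u = 0 on ∂Ω when Ω = B(R)) such that u(0,t) = max_{x ∈ Ω} u(x,t) for every t ∈ (0,T). If u blows up at t = T < ∞, then the blow-up is of type I, i.e., there exist constants C₁, C₂ such that C₁ ≤ log(T−t) + ‖u(·,t)‖_{L^∞} ≤ C₂ for every t ∈ (0,T). -/

import Mathlib

open MeasureTheory Real Filter Topology Metric Set
open scoped ENNReal NNReal

noncomputable section

namespace ExpBlowup

/-- Euclidean space `ℝ^N`. -/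
abbrev Euc (N : ℕ) := EuclideanSpace ℝ (Fin N)

/-- The Laplacian of a function `f : ℝ^N → ℝ` at a point `x`. -/
def lap {N : ℕ} (f : Euc N → ℝ) (x : Euc N) : ℝ :=
  ∑ i : Fin N, fderiv ℝ (fun y => fderiv ℝ f y (EuclideanSpace.single i 1)) x
    (EuclideanSpace.single i 1)

/-- The (extended-real valued) sup norm of `|v|` over a set `Ω`. -/
def supAbs {N : ℕ} (Ω : Set (Euc N)) (v : Euc N → ℝ) : ℝ≥0∞ :=
  ⨆ x ∈ Ω, ENNReal.ofReal |v x|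

/-- `u` blows up at time `T`. -/
def BlowsUpAt {N : ℕ} (Ω : Set (Euc N)) (u : ℝ → Euc N → ℝ) (T : ℝ) : Prop :=
  0 < T ∧ (∀ t ∈ Set.Ioo (0:ℝ) T, supAbs Ω (u t) < ⊤) ∧
    Filter.limsup (fun t => supAbs Ω (u t)) (𝓝[<] T) = ⊤

/-- The blow-up of `u` at time `T` is of type I. -/
def TypeIRate {N : ℕ} (Ω : Set (Euc N)) (u : ℝ → Euc N → ℝ) (T : ℝ) : Prop :=
  ∃ C₁ C₂ : ℝ, ∀ t ∈ Set.Ioo (0:ℝ) T,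
    C₁ ≤ Real.log (T - t) + (supAbs Ω (u t)).toReal ∧
      Real.log (T - t) + (supAbs Ω (u t)).toReal ≤ C₂

/-- `x₀` is a blow-up point of `u` (blowing up at time `T`). -/
def IsBlowUpPoint {N : ℕ} (Ω : Set (Euc N)) (u : ℝ → Euc N → ℝ) (T : ℝ) (x₀ : Euc N) : Prop :=
  ∃ x : ℕ → Euc N, ∃ t : ℕ → ℝ, (∀ n, x n ∈ Ω) ∧ (∀ n, t n ∈ Set.Ioo 0 T) ∧
    Filter.Tendsto x Filter.atTop (𝓝 x₀) ∧ Filter.Tendsto t Filter.atTop (𝓝 T) ∧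
    Filter.Tendsto (fun n => u (t n) (x n)) Filter.atTop Filter.atTop

/-- A function is radially symmetric. -/
def RadiallySymmetric {N : ℕ} (v : Euc N → ℝ) : Prop :=
  ∀ x y : Euc N, ‖x‖ = ‖y‖ → v x = v y

/-- A classical solution of `u_t = Δu + e^u` on `Ω` with Dirichlet boundary condition and
initial data `u₀`, for times in the set `I`. -/
structure IsClassicalSol {N : ℕ} (Ω : Set (Euc N)) (u : ℝ → Euc N → ℝ)
    (u₀ : Euc N → ℝ) (I : Set ℝ) : Prop where
  space_reg : ∀ t ∈ I, 0 < t → ContDiffOn ℝ 2 (u t) Ω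
  cont : ContinuousOn (fun p : ℝ × Euc N => u p.1 p.2) (I ×ˢ closure Ω)
  eq : ∀ t ∈ I, 0 < t → ∀ x ∈ Ω,
    HasDerivAt (fun s => u s x) (lap (u t) x + Real.exp (u t x)) t
  bc : ∀ t ∈ I, ∀ x ∈ frontier Ω, u t x = 0
  ic : ∀ x ∈ closure Ω, u 0 x = u₀ x

/-- An `L¹`-solution of `u_t = Δu + e^u` on `B(0,R) × [0,𝓣]` with Dirichlet boundary
conditions (Definition 1.1 of the paper). -/
structure IsL1Sol {N : ℕ} (R 𝓣 : ℝ) (u : ℝ → Euc N → ℝ) : Prop where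
  integrable : ∀ t ∈ Set.Icc (0:ℝ) 𝓣, IntegrableOn (u t) (ball (0:Euc N) R)
  contL1 : ∀ t₀ ∈ Set.Icc (0:ℝ) 𝓣,
    Filter.Tendsto (fun t => ∫ x in ball (0:Euc N) R, |u t x - u t₀ x|)
      (𝓝[Set.Icc (0:ℝ) 𝓣] t₀) (𝓝 0)
  exp_int : IntegrableOn (fun p : ℝ × Euc N => Real.exp (u p.1 p.2))
      (Set.Ioc (0:ℝ) 𝓣 ×ˢ ball (0:Euc N) R)
  weak : ∀ t₁ t₂, 0 ≤ t₁ → t₁ < t₂ → t₂ ≤ 𝓣 → ∀ Ψ : ℝ → Euc N → ℝ,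
    ContDiffOn ℝ 2 (fun p : ℝ × Euc N => Ψ p.1 p.2)
      (Set.Icc (0:ℝ) 𝓣 ×ˢ closure (ball (0:Euc N) R)) →
    (∀ t ∈ Set.Icc (0:ℝ) 𝓣, ∀ x ∈ sphere (0:Euc N) R, Ψ t x = 0) →
    ((∫ x in ball (0:Euc N) R, (u t₂ x * Ψ t₂ x - u t₁ x * Ψ t₁ x)) -
        ∫ t in t₁..t₂, ∫ x in ball (0:Euc N) R, u t x * deriv (fun s => Ψ s x) t)
      = ∫ t in t₁..t₂, ∫ x in ball (0:Euc N) R,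
          (u t x * lap (Ψ t) x + Real.exp (u t x) * Ψ t x)

/-- The approximation property defining limit `L¹`-solutions on `[0,𝓣)`:
`v n` are classical solutions with initial data `v₀ n` approximating `u`, `u₀`. -/
def IsLimitL1SolAux {N : ℕ} (R 𝓣 : ℝ) (u : ℝ → Euc N → ℝ) (u₀ : Euc N → ℝ)
    (v : ℕ → ℝ → Euc N → ℝ) (v₀ : ℕ → Euc N → ℝ) : Prop :=
  (∀ n, IsClassicalSol (ball (0:Euc N) R) (v n) (v₀ n) (Set.Ico 0 𝓣)) ∧
  (∀ n, ContinuousOn (v₀ n) (closure (ball (0:Euc N) R))) ∧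
  TendstoUniformlyOn v₀ u₀ Filter.atTop (closure (ball (0:Euc N) R)) ∧
  (∀ t ∈ Set.Ico (0:ℝ) 𝓣,
    Filter.Tendsto (fun n => ∫ x in ball (0:Euc N) R, |v n t x - u t x|)
      Filter.atTop (𝓝 0)) ∧
  (∀ t ∈ Set.Ico (0:ℝ) 𝓣, 0 < t →
    Filter.Tendsto (fun n => ∫ p in Set.Ioc (0:ℝ) t ×ˢ ball (0:Euc N) R,
      |Real.exp (v n p.1 p.2) - Real.exp (u p.1 p.2)|) Filter.atTop (𝓝 0))

/-- A limit `L¹`-solution of the problem on `[0,𝓣)`. -/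
def IsLimitL1Sol {N : ℕ} (R 𝓣 : ℝ) (u : ℝ → Euc N → ℝ) (u₀ : Euc N → ℝ) : Prop :=
  (∀ T' ∈ Set.Ico (0:ℝ) 𝓣, IsL1Sol R T' u) ∧
  ∃ v v₀, IsLimitL1SolAux R 𝓣 u u₀ v v₀

/-- A minimal (limit) `L¹`-solution of the problem on `[0,𝓣)`: a limit `L¹`-solution whose
approximating initial data increase monotonically. -/
def IsMinimalL1Sol {N : ℕ} (R 𝓣 : ℝ) (u : ℝ → Euc N → ℝ) (u₀ : Euc N → ℝ) : Prop :=
  (∀ T' ∈ Set.Ico (0:ℝ) 𝓣, IsL1Sol R T' u) ∧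
  ∃ v v₀, IsLimitL1SolAux R 𝓣 u u₀ v v₀ ∧
    ∀ n, ∀ x ∈ closure (ball (0:Euc N) R), 0 ≤ v₀ n x ∧ v₀ n x ≤ v₀ (n + 1) x

/-- A minimal `L¹`-solution on the closed time interval `[0,𝓣]`. -/
def IsMinimalL1SolClosed {N : ℕ} (R 𝓣 : ℝ) (u : ℝ → Euc N → ℝ) (u₀ : Euc N → ℝ) : Prop :=
  IsL1Sol R 𝓣 u ∧
  ∃ v v₀, IsLimitL1SolAux R 𝓣 u u₀ v v₀ ∧
    ∀ n, ∀ x ∈ closure (ball (0:Euc N) R), 0 ≤ v₀ n x ∧ v₀ n x ≤ v₀ (n + 1) x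

/-- The zero number (maximal number of sign changes) of `v` on `(0,R)`. -/
def zeroNumber (R : ℝ) (v : ℝ → ℝ) : ℕ∞ :=
  ⨆ k ∈ {k : ℕ | ∃ x : Fin (k + 1) → ℝ, StrictMono x ∧ (∀ i, x i ∈ Set.Ioo 0 R) ∧
      ∀ i : Fin k, v (x i.castSucc) * v (x i.succ) < 0}, (k : ℕ∞)

/-- Maximum principle for the product of the positive parts of two subsolutions in separate
variables. -/
theorem not_pos_of_two_point {X Y : Type*} [TopologicalSpace X] [TopologicalSpace Y]
    (K : Set (ℝ × X × Y)) (hK : IsCompact K) (f : ℝ → X → ℝ) (g : ℝ → Y → ℝ) (c : ℝ)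
    (hf : ContinuousOn (fun p : ℝ × X × Y => f p.1 p.2.1) K)
    (hg : ContinuousOn (fun p : ℝ × X × Y => g p.1 p.2.2) K)
    (hnhds : ∀ t x y, (t, x, y) ∈ K → 0 < f t x → 0 < g t y →
      (∀ᶠ x' in 𝓝 x, (t, x', y) ∈ K) ∧ (∀ᶠ y' in 𝓝 y, (t, x, y') ∈ K) ∧
      (∀ᶠ s in 𝓝[<] t, (s, x, y) ∈ K))
    (hfe : ∀ t x y, (t, x, y) ∈ K → 0 < f t x → 0 < g t y →
      ∃ f', HasDerivAt (fun s => f s x) f' t ∧ (IsLocalMax (f t) x → f' ≤ c * f t x))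
    (hge : ∀ t x y, (t, x, y) ∈ K → 0 < f t x → 0 < g t y →
      ∃ g', HasDerivAt (fun s => g s y) g' t ∧ (IsLocalMax (g t) y → g' ≤ c * g t y)) :
    ∀ t x y, (t, x, y) ∈ K → 0 < f t x → ¬ 0 < g t y := by
  intro t₀ x₀ y₀ hmem hf₀ hg₀
  set l : ℝ := 2 * c + 1 with hl
  let P : ℝ × X × Y → ℝ := fun p =>
    Real.exp (-l * p.1) * (max (f p.1 p.2.1) 0 * max (g p.1 p.2.2) 0)
  have hP : ContinuousOn P K := by
    refine ContinuousOn.mul ?_ ((hf.sup continuousOn_const).mul (hg.sup continuousOn_const))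
    exact (by fun_prop : Continuous fun p : ℝ × X × Y => Real.exp (-l * p.1)).continuousOn
  obtain ⟨⟨t, x, y⟩, hpK, hmax⟩ := hK.exists_isMaxOn ⟨_, hmem⟩ hP
  have h0 : 0 < P (t₀, x₀, y₀) := by
    simp only [P]
    rw [max_eq_left hf₀.le, max_eq_left hg₀.le]
    positivity
  have h1 : 0 < P (t, x, y) := lt_of_lt_of_le h0 (hmax hmem)
  have h2 : 0 < max (f t x) 0 * max (g t y) 0 := by
    have := Real.exp_pos (-l * t)
    exact (mul_pos_iff_of_pos_left this).1 h1
  have hfp : 0 < f t x := by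
    by_contra h
    rw [max_eq_right (not_lt.1 h)] at h2
    simp at h2
  have hgp : 0 < g t y := by
    by_contra h
    rw [max_eq_right (not_lt.1 h)] at h2
    simp at h2
  obtain ⟨hx, hy, ht⟩ := hnhds t x y hpK hfp hgp
  obtain ⟨f', hf', hf'm⟩ := hfe t x y hpK hfp hgp
  obtain ⟨g', hg', hg'm⟩ := hge t x y hpK hfp hgp
  have key : ∀ s x' y', (s, x', y') ∈ K → 0 < f s x' → 0 < g s y' →
      Real.exp (-l * s) * (f s x' * g s y') ≤ Real.exp (-l * t) * (f t x * g t y) := by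
    intro s x' y' hm h1 h2
    have := hmax hm
    simp only [P, mem_ofPred_eq] at this
    rwa [max_eq_left h1.le, max_eq_left h2.le, max_eq_left hfp.le, max_eq_left hgp.le] at this
  have hfm : IsLocalMax (f t) x := by
    filter_upwards [hx] with x' hx'
    by_contra h
    push Not at h
    have := key t x' y hx' (hfp.trans h) hgp
    have h3 := le_of_mul_le_mul_left this (Real.exp_pos _)
    exact absurd (le_of_mul_le_mul_right h3 hgp) (not_le.2 h)
  have hgm : IsLocalMax (g t) y := by
    filter_upwards [hy] with y' hy'
    by_contra h
    push Not at h
    have := key t x y' hy' hfp (hgp.trans h)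
    have h3 := le_of_mul_le_mul_left this (Real.exp_pos _)
    exact absurd (le_of_mul_le_mul_left h3 hfp) (not_le.2 h)
  have hfle := hf'm hfm
  have hgle := hg'm hgm
  have hd : HasDerivAt (fun s => Real.exp (-l * s) * (f s x * g s y))
      (Real.exp (-l * t) * (-l) * (f t x * g t y) +
        Real.exp (-l * t) * (f' * g t y + f t x * g')) t := by
    have he : HasDerivAt (fun s : ℝ => Real.exp (-l * s)) (Real.exp (-l * t) * (-l)) t := by
      simpa using ((hasDerivAt_id t).const_mul (-l)).exp
    exact he.mul (hf'.mul hg')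
  have hnonneg : 0 ≤ Real.exp (-l * t) * (-l) * (f t x * g t y) +
        Real.exp (-l * t) * (f' * g t y + f t x * g') := by
    have hslope := (hasDerivAt_iff_tendsto_slope.1 hd).mono_left
      (nhdsWithin_mono t (fun s (hs : s < t) => ne_of_lt hs) : 𝓝[<] t ≤ 𝓝[≠] t)
    refine ge_of_tendsto hslope ?_
    have e1 : ∀ᶠ s in 𝓝[<] t, 0 < f s x :=
      (hf'.continuousAt.eventually (lt_mem_nhds hfp)).filter_mono nhdsWithin_le_nhds
    have e2 : ∀ᶠ s in 𝓝[<] t, 0 < g s y :=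
      (hg'.continuousAt.eventually (lt_mem_nhds hgp)).filter_mono nhdsWithin_le_nhds
    filter_upwards [e1, e2, ht, self_mem_nhdsWithin] with s h1 h2 h3 h4
    have := key s x y h3 h1 h2
    rw [slope_def_field]
    exact div_nonneg_of_nonpos (by linarith) (by have : s < t := h4; linarith)
  have hneg : Real.exp (-l * t) * (-l) * (f t x * g t y) +
        Real.exp (-l * t) * (f' * g t y + f t x * g') < 0 := by
    have e := Real.exp_pos (-l * t)
    have a1 : f' * g t y ≤ c * f t x * g t y := mul_le_mul_of_nonneg_right hfle hgp.le
    have a2 : f t x * g' ≤ f t x * (c * g t y) := mul_le_mul_of_nonneg_left hgle hfp.le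
    have a3 : 0 < f t x * g t y := mul_pos hfp hgp
    have : Real.exp (-l * t) * (-l) * (f t x * g t y) +
        Real.exp (-l * t) * (f' * g t y + f t x * g') =
        Real.exp (-l * t) * (-l * (f t x * g t y) + (f' * g t y + f t x * g')) := by ring
    rw [this]
    refine mul_neg_of_pos_of_neg e ?_
    rw [hl]
    linarith
  linarith

/-- `f` is twice differentiable along the coordinate lines through `x`, and its second
derivatives there sum up to `L`. -/
def HasLap {N : ℕ} (f : Euc N → ℝ) (x : Euc N) (L : ℝ) : Prop :=
  ∃ (φ : Fin N → ℝ → ℝ) (d : Fin N → ℝ),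
    (∀ i, ∀ᶠ s in 𝓝 (0:ℝ),
      HasDerivAt (fun s : ℝ => f (x + s • EuclideanSpace.single i (1:ℝ))) (φ i s) s) ∧
    (∀ i, HasDerivAt (φ i) (d i) 0) ∧ ∑ i, d i = L

theorem HasLap.sub {N : ℕ} {f g : Euc N → ℝ} {x : Euc N} {L M : ℝ}
    (hf : HasLap f x L) (hg : HasLap g x M) : HasLap (fun y => f y - g y) x (L - M) := by
  obtain ⟨φ, d, h1, h2, h3⟩ := hf
  obtain ⟨ψ, e, k1, k2, k3⟩ := hg
  refine ⟨fun i s => φ i s - ψ i s, fun i => d i - e i, fun i => ?_,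
    fun i => (h2 i).sub (k2 i), by simp [h3, k3]⟩
  filter_upwards [h1 i, k1 i] with s a b using a.sub b

theorem HasLap.neg {N : ℕ} {f : Euc N → ℝ} {x : Euc N} {L : ℝ}
    (hf : HasLap f x L) : HasLap (fun y => - f y) x (-L) := by
  obtain ⟨φ, d, h1, h2, h3⟩ := hf
  refine ⟨fun i s => - φ i s, fun i => - d i, fun i => ?_, fun i => (h2 i).neg, by simp [h3]⟩
  filter_upwards [h1 i] with s a using a.neg

theorem nonpos_of_isLocalMax_of_hasDerivAt {φ φ' : ℝ → ℝ} {d : ℝ}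
    (hm : IsLocalMax φ 0) (h1 : ∀ᶠ s in 𝓝 (0:ℝ), HasDerivAt φ (φ' s) s)
    (h2 : HasDerivAt φ' d 0) : d ≤ 0 := by
  by_contra hd
  push Not at hd
  have h0 : φ' 0 = 0 := hm.hasDerivAt_eq_zero h1.self_of_nhds
  have hpos : ∀ᶠ s in 𝓝[>] (0:ℝ), 0 < φ' s := by
    have hslope := (hasDerivAt_iff_tendsto_slope.1 h2).mono_left
      (nhdsWithin_mono 0 (fun s (hs : 0 < s) => ne_of_gt hs) : 𝓝[>] (0:ℝ) ≤ 𝓝[≠] 0)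
    filter_upwards [hslope.eventually (lt_mem_nhds hd), self_mem_nhdsWithin] with s hs hs0
    rw [slope_def_field, h0] at hs
    have hs0' : (0:ℝ) < s := hs0
    simp only [sub_zero] at hs
    exact (div_pos_iff_of_pos_right hs0').1 hs
  have hall : ∀ᶠ s in 𝓝[>] (0:ℝ), 0 < φ' s ∧ HasDerivAt φ (φ' s) s ∧ φ s ≤ φ 0 :=
    hpos.and ((h1.filter_mono nhdsWithin_le_nhds).and (hm.filter_mono nhdsWithin_le_nhds))
  obtain ⟨ε, hε, hsub⟩ := mem_nhdsGT_iff_exists_Ioo_subset.1 hall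
  have hε' : (0:ℝ) < ε := hε
  have hmem : ε / 2 ∈ Ioo 0 ε := ⟨by linarith, by linarith⟩
  have hcont : ContinuousOn φ (Icc 0 (ε / 2)) := by
    intro s hs
    rcases eq_or_lt_of_le hs.1 with h | h
    · rw [← h]; exact h1.self_of_nhds.continuousAt.continuousWithinAt
    · exact (hsub ⟨h, by linarith [hs.2]⟩).2.1.continuousAt.continuousWithinAt
  obtain ⟨c, hc, hce⟩ := exists_hasDerivAt_eq_slope φ φ' hmem.1 hcont
    (fun s hs => (hsub ⟨hs.1, by linarith [hs.2]⟩).2.1)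
  have p1 := (hsub ⟨hc.1, by linarith [hc.2]⟩ : _ ∧ _).1
  have p2 := (hsub hmem : _ ∧ _).2.2
  rw [hce] at p1
  have := (div_pos_iff_of_pos_right (by linarith : (0:ℝ) < ε / 2 - 0)).1 p1
  linarith

theorem HasLap.nonpos_of_isLocalMax {N : ℕ} {f : Euc N → ℝ} {x : Euc N} {L : ℝ}
    (hf : HasLap f x L) (hm : IsLocalMax f x) : L ≤ 0 := by
  obtain ⟨φ, d, h1, h2, h3⟩ := hf
  rw [← h3]
  refine Finset.sum_nonpos fun i _ => ?_
  refine nonpos_of_isLocalMax_of_hasDerivAt ?_ (h1 i) (h2 i)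
  have hc : ContinuousAt (fun s : ℝ => x + s • EuclideanSpace.single i (1:ℝ)) 0 := by fun_prop
  have hx : x + (0:ℝ) • EuclideanSpace.single i (1:ℝ) = x := by simp
  have := hc.eventually (p := fun y => f y ≤ f x) (by beta_reduce; rw [hx]; exact hm)
  filter_upwards [this] with s hs
  simpa using hs

theorem hasLap_lap {N : ℕ} {f : Euc N → ℝ} {x : Euc N} (hf : ContDiffAt ℝ 2 f x) :
    HasLap f x (lap f x) := by
  have hline : ∀ (i : Fin N) (s : ℝ),
      HasDerivAt (fun s : ℝ => x + s • EuclideanSpace.single i (1:ℝ))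
        (EuclideanSpace.single i (1:ℝ)) s := by
    intro i s
    simpa using ((hasDerivAt_id s).smul_const (EuclideanSpace.single i (1:ℝ))).const_add x
  refine ⟨fun i s => fderiv ℝ f (x + s • EuclideanSpace.single i (1:ℝ))
      (EuclideanSpace.single i 1), fun i => fderiv ℝ
      (fun y => fderiv ℝ f y (EuclideanSpace.single i 1)) x (EuclideanSpace.single i 1),
      fun i => ?_, fun i => ?_, rfl⟩
  · have h1 : ∀ᶠ y in 𝓝 x, DifferentiableAt ℝ f y := by
      filter_upwards [hf.eventually (by simp)] with y hy using hy.differentiableAt (by simp)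
    have hc : ContinuousAt (fun s : ℝ => x + s • EuclideanSpace.single i (1:ℝ)) 0 := by fun_prop
    have hx : x + (0:ℝ) • EuclideanSpace.single i (1:ℝ) = x := by simp
    have := hc.eventually (p := fun y => DifferentiableAt ℝ f y) (by beta_reduce; rw [hx]; exact h1)
    filter_upwards [this] with s hs
    exact hs.hasFDerivAt.comp_hasDerivAt s (hline i s)
  · have h2 : DifferentiableAt ℝ (fun y => fderiv ℝ f y (EuclideanSpace.single i 1)) x := by
      have : ContDiffAt ℝ 1 (fderiv ℝ f) x := hf.fderiv_right (by norm_num)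
      exact (this.differentiableAt (by simp)).clm_apply (differentiableAt_const _)
    have h3 := h2.hasFDerivAt
    have hx : x + (0:ℝ) • EuclideanSpace.single i (1:ℝ) = x := by simp
    rw [← hx] at h3
    have h4 := h3.comp_hasDerivAt (0:ℝ) (hline i 0)
    rw [hx] at h4
    exact h4

theorem norm_sq_add_smul_single {N : ℕ} (x : Euc N) (i : Fin N) (s : ℝ) :
    ‖x + s • EuclideanSpace.single i (1:ℝ)‖ ^ 2 = ‖x‖ ^ 2 + 2 * s * x i + s ^ 2 := by
  rw [norm_add_sq_real, norm_smul, inner_smul_right]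
  simp [EuclideanSpace.inner_single_right]
  ring

/-- The Laplacian of a radial function, written as a function of `‖x‖ ^ 2`. -/
theorem hasLap_radial {N : ℕ} {Φ Φ' : ℝ → ℝ} {a : ℝ} {x : Euc N}
    (h1 : ∀ ξ, HasDerivAt Φ (Φ' ξ) ξ) (hc : Continuous Φ')
    (h2 : x ≠ 0 → HasDerivAt Φ' a (‖x‖ ^ 2)) :
    HasLap (fun y => Φ (‖y‖ ^ 2)) x (4 * ‖x‖ ^ 2 * a + 2 * N * Φ' (‖x‖ ^ 2)) := by
  have hq : ∀ (i : Fin N) (s : ℝ),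
      HasDerivAt (fun s : ℝ => ‖x‖ ^ 2 + 2 * s * x i + s ^ 2) (2 * (x i + s)) s := by
    intro i s
    have := ((((hasDerivAt_id s).const_mul 2).mul_const (x i)).const_add (‖x‖ ^ 2)).add
      ((hasDerivAt_id s).pow 2)
    refine this.congr_deriv ?_
    simp
    ring
  refine ⟨fun i s => Φ' (‖x‖ ^ 2 + 2 * s * x i + s ^ 2) * (2 * (x i + s)),
    fun i => a * (2 * x i) * (2 * x i) + Φ' (‖x‖ ^ 2) * 2, fun i => ?_, fun i => ?_, ?_⟩
  · refine Eventually.of_forall fun s => ?_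
    simp_rw [norm_sq_add_smul_single]
    exact (h1 _).comp s (hq i s)
  · have hl : HasDerivAt (fun s : ℝ => 2 * (x i + s)) 2 0 := by
      simpa using ((hasDerivAt_id (0:ℝ)).const_add (x i)).const_mul 2
    by_cases hx : x = 0
    · subst hx
      have hsl : HasDerivAt (fun s : ℝ => Φ' (s ^ 2) * (2 * s)) (Φ' 0 * 2) 0 := by
        rw [hasDerivAt_iff_tendsto_slope]
        have hcc : Tendsto (fun s : ℝ => Φ' (s ^ 2) * 2) (𝓝[≠] 0) (𝓝 (Φ' 0 * 2)) := by
          have : Continuous fun s : ℝ => Φ' (s ^ 2) * 2 := by fun_prop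
          have := this.tendsto 0
          simp only [ne_eq, OfNat.ofNat_ne_zero, not_false_eq_true, zero_pow] at this
          exact this.mono_left nhdsWithin_le_nhds
        refine hcc.congr' ?_
        filter_upwards [self_mem_nhdsWithin] with s hs
        have hs' : s ≠ 0 := hs
        rw [slope_def_field]
        field_simp
        simp [mul_comm]
      simpa using hsl
    · have h3 : HasDerivAt Φ' a (‖x‖ ^ 2 + 2 * 0 * x i + 0 ^ 2) := by simpa using h2 hx
      have h4 := (h3.comp (0:ℝ) (hq i 0)).mul hl
      refine h4.congr_deriv ?_
      simp
  · have hn : ∑ i, x i ^ 2 = ‖x‖ ^ 2 := by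
      rw [EuclideanSpace.norm_sq_eq]; simp
    have : ∀ i, a * (2 * x i) * (2 * x i) + Φ' (‖x‖ ^ 2) * 2 =
        4 * a * x i ^ 2 + Φ' (‖x‖ ^ 2) * 2 := fun i => by ring
    simp_rw [this]
    rw [Finset.sum_add_distrib, ← Finset.mul_sum, hn]
    simp
    ring

/-- The right-hand side of the radial profile equation, written as an average. -/
def profileSlope (n F : ℝ → ℝ) (s : ℝ) : ℝ :=
  -∫ θ in (0:ℝ)..1, Real.exp ((1 - θ) * s / 4) * n (F (θ * s))

theorem continuous_profileSlope {n F : ℝ → ℝ} (hn : Continuous n) (hF : Continuous F) :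
    Continuous (profileSlope n F) := by
  unfold profileSlope
  refine Continuous.neg ?_
  refine intervalIntegral.continuous_parametric_intervalIntegral_of_continuous' ?_ 0 1
  simp only [Function.uncurry_def]
  fun_prop

theorem mul_profileSlope {n F : ℝ → ℝ} (s : ℝ) :
    s * profileSlope n F s =
      -(Real.exp (s / 4) * ∫ σ in (0:ℝ)..s, Real.exp (-σ / 4) * n (F σ)) := by
  have h := intervalIntegral.smul_integral_comp_mul_right (a := 0) (b := 1)
    (fun σ => Real.exp ((s - σ) / 4) * n (F σ)) s
  simp only [zero_mul, one_mul, smul_eq_mul] at h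
  unfold profileSlope
  rw [mul_neg, ← intervalIntegral.integral_const_mul (Real.exp (s / 4))]
  congr 1
  have e1 : ∀ θ : ℝ, Real.exp ((1 - θ) * s / 4) * n (F (θ * s)) =
      Real.exp ((s - θ * s) / 4) * n (F (θ * s)) := fun θ => by congr 2; ring
  have e2 : ∀ σ : ℝ, Real.exp (s / 4) * (Real.exp (-σ / 4) * n (F σ)) =
      Real.exp ((s - σ) / 4) * n (F σ) := fun σ => by
    rw [← mul_assoc, ← Real.exp_add]; congr 2; ring
  simp_rw [e1, e2]
  exact h

theorem abs_profileSlope_sub_le {n F G : ℝ → ℝ} {l c M Z s : ℝ} (hn : Continuous n)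
    (hF : Continuous F) (hG : Continuous G) (hl : 0 ≤ l)
    (hlip : ∀ a b, |n a - n b| ≤ l * |a - b|) (hc : 0 ≤ c) (hM : 0 ≤ M)
    (hs : s ∈ Icc 0 Z)
    (hFG : ∀ σ ∈ Icc 0 Z, |F σ - G σ| ≤ Real.exp (c * σ) * M) :
    |profileSlope n F s - profileSlope n G s| ≤ Real.exp (Z / 4) * l * M * Real.exp (c * s) := by
  have hi : ∀ H : ℝ → ℝ, Continuous H → IntervalIntegrable
      (fun θ : ℝ => Real.exp ((1 - θ) * s / 4) * n (H (θ * s))) volume 0 1 := fun H hH => by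
    refine Continuous.intervalIntegrable ?_ _ _
    fun_prop
  unfold profileSlope
  rw [neg_sub_neg, ← intervalIntegral.integral_sub (hi G hG) (hi F hF)]
  have := intervalIntegral.norm_integral_le_of_norm_le_const (a := (0:ℝ)) (b := 1)
    (f := fun θ : ℝ => Real.exp ((1 - θ) * s / 4) * n (G (θ * s)) -
      Real.exp ((1 - θ) * s / 4) * n (F (θ * s)))
    (C := Real.exp (Z / 4) * l * M * Real.exp (c * s)) ?_
  · simpa using this
  intro θ hθ
  rw [uIoc_of_le zero_le_one] at hθ
  have h1 : θ * s ∈ Icc 0 Z :=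
    ⟨mul_nonneg hθ.1.le hs.1, by nlinarith [hθ.2, hs.1, hs.2]⟩
  rw [← mul_sub, Real.norm_eq_abs, abs_mul, abs_of_pos (Real.exp_pos _)]
  have a1 : Real.exp ((1 - θ) * s / 4) ≤ Real.exp (Z / 4) := by
    apply Real.exp_le_exp.2
    nlinarith [hθ.1, hs.1, hs.2]
  have a2 : |n (G (θ * s)) - n (F (θ * s))| ≤ l * (Real.exp (c * s) * M) := by
    refine (hlip _ _).trans (mul_le_mul_of_nonneg_left ?_ hl)
    rw [abs_sub_comm]
    refine (hFG _ h1).trans (mul_le_mul_of_nonneg_right ?_ hM)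
    apply Real.exp_le_exp.2
    apply mul_le_mul_of_nonneg_left _ hc
    nlinarith [hθ.2, hs.1]
  calc _ ≤ Real.exp (Z / 4) * (l * (Real.exp (c * s) * M)) :=
        mul_le_mul a1 a2 (abs_nonneg _) (Real.exp_pos _).le
    _ = _ := by ring

theorem exists_profile {n : ℝ → ℝ} {l : ℝ} (hl : 0 < l)
    (hlip : ∀ a b, |n a - n b| ≤ l * |a - b|) (α : ℝ) {Z : ℝ} (hZ : 0 ≤ Z) :
    ∃ F F' : ℝ → ℝ, Continuous F' ∧ (∀ ξ, HasDerivAt F (F' ξ) ξ) ∧ F 0 = α ∧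
      ∀ ξ ∈ Icc 0 Z, F' ξ = profileSlope n F ξ := by
  have hn : Continuous n := by
    have : LipschitzWith ⟨l, hl.le⟩ n := LipschitzWith.of_dist_le_mul fun a b => hlip a b
    exact this.continuous
  set c : ℝ := 2 * (Real.exp (Z / 4) * l) with hc
  have hc0 : 0 < c := by positivity
  let ext : C(Icc 0 Z, ℝ) → ℝ → ℝ := fun g s => Real.exp (c * s) * IccExtend hZ g s
  have hext : ∀ g, Continuous (ext g) := fun g => by
    have : Continuous (IccExtend hZ g) := g.continuous.Icc_extend'
    simp only [ext]
    fun_prop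
  have hext' : ∀ g (s : ℝ) (hs : s ∈ Icc 0 Z), ext g s = Real.exp (c * s) * g ⟨s, hs⟩ := by
    intro g s hs
    simp only [ext]
    rw [IccExtend_of_mem hZ g hs]
  let S : C(Icc 0 Z, ℝ) → ℝ → ℝ := fun g ξ => α + ∫ s in (0:ℝ)..ξ, profileSlope n (ext g) s
  have hD : ∀ g, Continuous (profileSlope n (ext g)) := fun g =>
    continuous_profileSlope hn (hext g)
  have hSd : ∀ g ξ, HasDerivAt (S g) (profileSlope n (ext g) ξ) ξ := fun g ξ =>
    ((hD g).integral_hasStrictDerivAt 0 ξ).hasDerivAt.const_add α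
  have hSc : ∀ g, Continuous (S g) := fun g =>
    continuous_iff_continuousAt.2 fun ξ => (hSd g ξ).continuousAt
  let Tm : C(Icc 0 Z, ℝ) → C(Icc 0 Z, ℝ) := fun g =>
    ⟨fun ξ => Real.exp (-(c * ξ)) * S g ξ, by
      have := hSc g
      fun_prop⟩
  have hcontr : ContractingWith (1 / 2) Tm := by
    refine ⟨by rw [← NNReal.coe_lt_coe]; norm_num, LipschitzWith.of_dist_le_mul fun g h => ?_⟩
    rw [ContinuousMap.dist_le (by positivity)]
    intro ξ
    have hb : ∀ s ∈ Icc 0 Z, |profileSlope n (ext g) s - profileSlope n (ext h) s| ≤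
        Real.exp (Z / 4) * l * dist g h * Real.exp (c * s) := by
      intro s hs
      refine abs_profileSlope_sub_le hn (hext g) (hext h) hl.le hlip hc0.le dist_nonneg hs ?_
      intro σ hσ
      rw [hext' g σ hσ, hext' h σ hσ, ← mul_sub, abs_mul, abs_of_pos (Real.exp_pos _)]
      exact mul_le_mul_of_nonneg_left (ContinuousMap.dist_apply_le_dist (f := g) (g := h) _)
        (Real.exp_pos _).le
    have hξ := ξ.2
    have hint : |S g ξ - S h ξ| ≤ dist g h / 2 * Real.exp (c * ξ) := by
      simp only [S]
      rw [add_sub_add_left_eq_sub, ← intervalIntegral.integral_sub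
        ((hD g).intervalIntegrable _ _) ((hD h).intervalIntegrable _ _)]
      have h1 := intervalIntegral.norm_integral_le_of_norm_le (a := (0:ℝ)) (b := (ξ:ℝ))
        (μ := volume)
        (f := fun s => profileSlope n (ext g) s - profileSlope n (ext h) s)
        (g := fun s => Real.exp (Z / 4) * l * dist g h * Real.exp (c * s)) hξ.1
        (Eventually.of_forall fun s hs => hb s ⟨hs.1.le, hs.2.trans hξ.2⟩)
        (Continuous.intervalIntegrable (by fun_prop) _ _)
      refine h1.trans ?_
      have h2 : ∫ s in (0:ℝ)..ξ, Real.exp (Z / 4) * l * dist g h * Real.exp (c * s) =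
          dist g h / 2 * (Real.exp (c * ξ) - 1) := by
        have hd : ∀ s ∈ uIcc (0:ℝ) ξ, HasDerivAt (fun s => dist g h / 2 * Real.exp (c * s))
            (Real.exp (Z / 4) * l * dist g h * Real.exp (c * s)) s := by
          intro s _
          have := (((hasDerivAt_id s).const_mul c).exp).const_mul (dist g h / 2)
          refine this.congr_deriv ?_
          rw [mul_one, id, hc]
          ring
        rw [intervalIntegral.integral_eq_sub_of_hasDerivAt hd
          (Continuous.intervalIntegrable (by fun_prop) _ _)]
        simp
        ring
      rw [h2]
      refine mul_le_mul_of_nonneg_left (by linarith) (by positivity)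
    rw [Real.dist_eq]
    simp only [Tm, ContinuousMap.coe_mk]
    rw [← mul_sub, abs_mul, abs_of_pos (Real.exp_pos _)]
    calc _ ≤ Real.exp (-(c * ξ)) * (dist g h / 2 * Real.exp (c * ξ)) :=
          mul_le_mul_of_nonneg_left hint (Real.exp_pos _).le
      _ = dist g h / 2 * (Real.exp (-(c * ξ)) * Real.exp (c * ξ)) := by ring
      _ = dist g h / 2 := by rw [← Real.exp_add]; simp
      _ = _ := by push_cast; ring
  have : Nonempty C(Icc 0 Z, ℝ) := ⟨0⟩
  obtain ⟨g, hg⟩ : ∃ g, Tm g = g := ⟨_, hcontr.fixedPoint_isFixedPt⟩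
  have hfix : ∀ ξ ∈ Icc 0 Z, ext g ξ = S g ξ := by
    intro ξ hξ
    rw [hext' g ξ hξ]
    have : g ⟨ξ, hξ⟩ = Real.exp (-(c * ξ)) * S g ξ := by
      conv_lhs => rw [← hg]
      rfl
    rw [this, ← mul_assoc, ← Real.exp_add]
    simp
  refine ⟨S g, profileSlope n (ext g), hD g, hSd g, by simp [S], fun ξ hξ => ?_⟩
  unfold profileSlope
  congr 1
  refine intervalIntegral.integral_congr fun θ hθ => ?_
  rw [uIcc_of_le zero_le_one] at hθ
  have h1 : θ * ξ ∈ Icc 0 Z :=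
    ⟨mul_nonneg hθ.1 hξ.1, by nlinarith [hθ.2, hξ.1, hξ.2]⟩
  simp only [hfix _ h1]

theorem exp_sub_exp_le (a b : ℝ) : Real.exp a - Real.exp b ≤ Real.exp a * (a - b) := by
  have h1 : Real.exp b = Real.exp a * Real.exp (b - a) := by rw [← Real.exp_add]; congr 1; ring
  have h2 := Real.add_one_le_exp (b - a)
  have h3 := Real.exp_pos a
  rw [h1]
  nlinarith

/-- The reaction term of the profile equation, truncated at height `α`. -/
def truncReaction (α y : ℝ) : ℝ := (Real.exp (min y α) - 1) / 4

theorem abs_truncReaction_sub_le (α a b : ℝ) :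
    |truncReaction α a - truncReaction α b| ≤ Real.exp α / 4 * |a - b| := by
  have key : ∀ a b : ℝ, b ≤ a →
      |truncReaction α a - truncReaction α b| ≤ Real.exp α / 4 * |a - b| := by
    intro a b hab
    have h1 : min b α ≤ min a α := min_le_min_right α hab
    have h2 : min a α - min b α ≤ a - b := by
      rcases min_cases a α with h | h <;> rcases min_cases b α with h' | h' <;> linarith
    have h3 : Real.exp (min a α) ≤ Real.exp α := Real.exp_le_exp.2 (min_le_right _ _)
    have h4 := exp_sub_exp_le (min a α) (min b α)
    have h5 : Real.exp (min b α) ≤ Real.exp (min a α) := Real.exp_le_exp.2 h1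
    have h6 : Real.exp (min a α) * (min a α - min b α) ≤ Real.exp α * (a - b) :=
      mul_le_mul h3 h2 (by linarith) (Real.exp_pos _).le
    unfold truncReaction
    rw [abs_of_nonneg (by linarith), abs_of_nonneg (by linarith)]
    linarith
  rcases le_total b a with h | h
  · exact key a b h
  · rw [abs_sub_comm, abs_sub_comm a b]
    exact key b a h

/-- The flux of a solution of the profile equation is bounded below by a barrier. -/
theorem flux_lower_bound {F p : ℝ → ℝ} {ξ₁ ξ₃ Y : ℝ} (hξ₁ : 0 < ξ₁)
    (hξ₃ : Real.log (ξ₃ / ξ₁) = 112) (h13 : ξ₁ ≤ ξ₃) (hsmall : ξ₃ < 1 / 20)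
    (hF : ∀ ξ, 0 < ξ → ξ < Y → HasDerivAt F (-p ξ / ξ) ξ)
    (hFc : Continuous F) (hpc : Continuous p) (hp0 : p 0 = 0)
    (hp : ∀ ξ, 0 < ξ → ξ < Y → HasDerivAt p (p ξ / 4 + (Real.exp (F ξ) - 1) / 4) ξ)
    (hp1 : 1 / 10 ≤ p ξ₁) :
    (∀ ξ, ξ₁ ≤ ξ → ξ ≤ ξ₃ → ξ ≤ Y → 1 / 10 + 1 / 80 * Real.log (ξ / ξ₁) ≤ p ξ) ∧
      ∀ ξ, ξ₃ ≤ ξ → ξ ≤ Y → 3 / 2 ≤ p ξ := by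
  have hE : ∀ ξ, 0 ≤ ξ → ξ ≤ Y → 4 * p ξ - 2 * p ξ ^ 2 ≤ ξ * Real.exp (F ξ) := by
    intro ξ h0 hY
    have hd : ∀ x ∈ interior (Icc 0 Y), HasDerivAt
        (fun x => 2 * p x ^ 2 - 4 * p x + x * Real.exp (F x)) ((p x - 1) ^ 2) x := by
      intro x hx
      rw [interior_Icc] at hx
      have d1 := hp x hx.1 hx.2
      have d2 := (hF x hx.1 hx.2).exp
      have d3 := (((d1.pow 2).const_mul 2).sub (d1.const_mul 4)).add ((hasDerivAt_id x).mul d2)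
      refine d3.congr_deriv ?_
      have : x ≠ 0 := hx.1.ne'
      simp only [id]
      field_simp
      ring
    have hmono : MonotoneOn (fun x => 2 * p x ^ 2 - 4 * p x + x * Real.exp (F x)) (Icc 0 Y) := by
      refine monotoneOn_of_deriv_nonneg (convex_Icc 0 Y) (by fun_prop)
        (fun x hx => (hd x hx).differentiableAt.differentiableWithinAt) fun x hx => ?_
      rw [(hd x hx).deriv]
      positivity
    have := hmono ⟨le_refl _, h0.trans hY⟩ ⟨h0, hY⟩ h0
    simp only [hp0] at this
    linarith
  have hpd : ∀ ξ, 0 < ξ → ξ < Y → ξ * (p ξ / 4 + (Real.exp (F ξ) - 1) / 4) ≥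
      ξ * p ξ / 4 + (4 * p ξ - 2 * p ξ ^ 2 - ξ) / 4 := by
    intro ξ h0 hY
    have := hE ξ h0.le hY.le
    linarith
  have part1 : ∀ ξ, ξ₁ ≤ ξ → ξ ≤ ξ₃ → ξ ≤ Y → 1 / 10 + 1 / 80 * Real.log (ξ / ξ₁) ≤ p ξ := by
    intro ξ h1 h3 hY
    have hb : ∀ x, 0 < x → HasDerivAt (fun x => 1 / 10 + 1 / 80 * Real.log (x / ξ₁))
        (1 / 80 * (1 / x)) x := by
      intro x hx
      have := ((((hasDerivAt_id x).div_const ξ₁).log (div_pos hx hξ₁).ne').const_mul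
        (1 / 80)).const_add (1 / 10)
      refine this.congr_deriv ?_
      simp only [id]
      field_simp
    refine image_le_of_deriv_right_lt_deriv_boundary' (a := ξ₁) (b := ξ)
      (f := fun x => 1 / 10 + 1 / 80 * Real.log (x / ξ₁)) (f' := fun x => 1 / 80 * (1 / x))
      (fun x hx => (hb x (hξ₁.trans_le hx.1)).continuousAt.continuousWithinAt)
      (fun x hx => (hb x (hξ₁.trans_le hx.1)).hasDerivWithinAt) ?_ hpc.continuousOn
      (fun x hx => (hp x (hξ₁.trans_le hx.1) (hx.2.trans_le hY)).hasDerivWithinAt) ?_ ⟨h1, le_rfl⟩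
    · simpa [div_self hξ₁.ne'] using hp1
    · intro x hx heq
      have hx0 : 0 < x := hξ₁.trans_le hx.1
      have hlog0 : 0 ≤ Real.log (x / ξ₁) := Real.log_nonneg ((one_le_div hξ₁).2 hx.1)
      have hlog1 : Real.log (x / ξ₁) ≤ 112 := by
        rw [← hξ₃]
        exact Real.log_le_log (div_pos hx0 hξ₁)
          (div_le_div_of_nonneg_right (hx.2.le.trans h3) hξ₁.le)
      have hxs : x < 1 / 20 := (hx.2.le.trans h3).trans_lt hsmall
      have hd := hpd x hx0 (hx.2.trans_le hY)
      have hpl : 1 / 10 ≤ p x := by linarith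
      have hpu : p x ≤ 3 / 2 := by linarith
      have : 1 / 80 < x * (p x / 4 + (Real.exp (F x) - 1) / 4) := by nlinarith
      rw [mul_one_div, div_lt_iff₀ hx0]
      linarith
  refine ⟨part1, fun ξ h3 hY => ?_⟩
  have hp3 : 3 / 2 ≤ p ξ₃ := by
    have := part1 ξ₃ h13 le_rfl (h3.trans hY)
    rw [hξ₃] at this
    linarith
  have hξ₃0 := hξ₁.trans_le h13
  refine image_le_of_deriv_right_lt_deriv_boundary' (a := ξ₃) (b := ξ)
    (f := fun _ => 3 / 2) (f' := fun _ => 0) continuousOn_const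
    (fun x hx => (hasDerivAt_const _ _).hasDerivWithinAt) hp3 hpc.continuousOn
    (fun x hx => (hp x (hξ₃0.trans_le hx.1) (hx.2.trans_le hY)).hasDerivWithinAt) ?_ ⟨h3, le_rfl⟩
  intro x hx heq
  have hx0 : 0 < x := hξ₃0.trans_le hx.1
  have hd := hpd x hx0 (hx.2.trans_le hY)
  rw [← heq] at hd ⊢
  have : 0 < x * (3 / 2 / 4 + (Real.exp (F x) - 1) / 4) := by nlinarith
  exact (mul_pos_iff_of_pos_left hx0).1 this

/-- A decreasing profile with large value `α` at the origin solving, as a function of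
`ξ = |y| ^ 2`, the equation of backward self-similar solutions, together with decay bounds. -/
theorem exists_steep_profile {α Z : ℝ} (hα : 132 ≤ α) (hZ : 1 ≤ Z) :
    ∃ F F' : ℝ → ℝ, Continuous F' ∧ (∀ ξ, HasDerivAt F (F' ξ) ξ) ∧ F 0 = α ∧
      4 * F' 0 = 1 - Real.exp α ∧
      (∀ ξ, 0 < ξ → ξ < Z → ∃ a, HasDerivAt F' a ξ ∧
        4 * ξ * a + 4 * F' ξ - ξ * F' ξ + Real.exp (F ξ) - 1 = 0) ∧
      (∀ ξ, 0 ≤ ξ → ξ ≤ Z → F ξ ≤ α) ∧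
      (∀ a b, 0 ≤ a → a ≤ b → b ≤ Z → F a < α - 1 / 2 →
        1 / 10 * (Real.log b - Real.log a) ≤ F a - F b) ∧
      (∀ ξ, Real.exp (112 - α) ≤ ξ → ξ ≤ Z → F ξ ≤ α - 3 / 2 * (Real.log ξ - (112 - α))) := by
  have hl : 0 < Real.exp α / 4 := by positivity
  obtain ⟨F, F', hF'c, hFd, hF0, hF'⟩ := exists_profile hl (abs_truncReaction_sub_le α) α
    (zero_le_one.trans hZ)
  have hFc : Continuous F := continuous_iff_continuousAt.2 fun ξ => (hFd ξ).continuousAt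
  have hnc : Continuous (truncReaction α) := by unfold truncReaction; fun_prop
  have hexp : 133 ≤ Real.exp α := by linarith [Real.add_one_le_exp α]
  set ξ₁ := Real.exp (-α) with hξ₁
  set ξ₃ := Real.exp (112 - α) with hξ₃
  have hξ₁0 : 0 < ξ₁ := Real.exp_pos _
  have hξ₃0 : 0 < ξ₃ := Real.exp_pos _
  have h13 : ξ₁ ≤ ξ₃ := Real.exp_le_exp.2 (by linarith)
  have hinv : ξ₁ * Real.exp α = 1 := by rw [hξ₁, ← Real.exp_add]; simp
  have hs3 : ξ₃ < 1 / 20 := by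
    have h1 : ξ₃ ≤ Real.exp (-20) := Real.exp_le_exp.2 (by linarith)
    have h2 : Real.exp (-20) * Real.exp 20 = 1 := by rw [← Real.exp_add]; simp
    have h3 := Real.add_one_le_exp (20:ℝ)
    have h4 := Real.exp_pos (-20)
    nlinarith
  have hlog : Real.log (ξ₃ / ξ₁) = 112 := by
    rw [hξ₁, hξ₃, ← Real.exp_sub, Real.log_exp]; ring
  have h1Z : ξ₁ ≤ Z := by linarith
  have hflux : ∀ ξ, 0 < ξ → ξ < Z →
      HasDerivAt (fun ξ => -(ξ * F' ξ)) (-(ξ * F' ξ) / 4 + truncReaction α (F ξ)) ξ := by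
    intro ξ h0 h1
    have hI : HasDerivAt (fun x => Real.exp (x / 4) *
        ∫ σ in (0:ℝ)..x, Real.exp (-σ / 4) * truncReaction α (F σ))
        (Real.exp (ξ / 4) * (1 / 4) * (∫ σ in (0:ℝ)..ξ, Real.exp (-σ / 4) * truncReaction α (F σ))
          + Real.exp (ξ / 4) * (Real.exp (-ξ / 4) * truncReaction α (F ξ))) ξ := by
      refine HasDerivAt.mul ?_ ?_
      · exact ((hasDerivAt_id ξ).div_const 4).exp
      · have hc : Continuous fun σ => Real.exp (-σ / 4) * truncReaction α (F σ) := by fun_prop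
        exact (hc.integral_hasStrictDerivAt 0 ξ).hasDerivAt
    have heq : (fun ξ => -(ξ * F' ξ)) =ᶠ[𝓝 ξ] fun x => Real.exp (x / 4) *
        ∫ σ in (0:ℝ)..x, Real.exp (-σ / 4) * truncReaction α (F σ) := by
      filter_upwards [Ioo_mem_nhds h0 h1] with x hx
      rw [hF' x ⟨hx.1.le, hx.2.le⟩, mul_profileSlope]
      ring
    refine (hI.congr_of_eventuallyEq heq).congr_deriv ?_
    have e1 := heq.self_of_nhds
    simp only at e1
    rw [e1, ← mul_assoc, ← Real.exp_add]
    have : ξ / 4 + -ξ / 4 = 0 := by ring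
    rw [this, Real.exp_zero]
    ring
  have hF'lb : ∀ s ∈ Icc 0 ξ₁, ‖F' s‖ ≤ Real.exp α / 2 := by
    intro s hs
    rw [hF' s ⟨hs.1, hs.2.trans h1Z⟩]
    unfold profileSlope
    rw [norm_neg]
    refine (intervalIntegral.norm_integral_le_of_norm_le_const (C := Real.exp α / 2) ?_).trans
      (by simp)
    intro θ hθ
    rw [uIoc_of_le zero_le_one] at hθ
    rw [norm_mul, Real.norm_eq_abs, Real.norm_eq_abs, abs_of_pos (Real.exp_pos _)]
    have a1 : Real.exp ((1 - θ) * s / 4) ≤ 2 := by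
      have : Real.exp ((1 - θ) * s / 4) ≤ Real.exp (Real.log 2) := by
        apply Real.exp_le_exp.2
        have := Real.log_two_gt_d9
        nlinarith [hθ.1, hs.1, hs.2, hθ.2]
      rwa [Real.exp_log (by norm_num)] at this
    have a2 : |truncReaction α (F (θ * s))| ≤ Real.exp α / 4 := by
      unfold truncReaction
      have b1 : Real.exp (min (F (θ * s)) α) ≤ Real.exp α := Real.exp_le_exp.2 (min_le_right _ _)
      have b2 := Real.exp_pos (min (F (θ * s)) α)
      rw [abs_le]
      constructor <;> linarith
    calc _ ≤ 2 * (Real.exp α / 4) := mul_le_mul a1 a2 (abs_nonneg _) (by norm_num)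
      _ = _ := by ring
  have hFlb : ∀ s ∈ Icc 0 ξ₁, α - 1 / 2 ≤ F s := by
    intro s hs
    have := norm_image_sub_le_of_norm_deriv_le_segment' (f := F) (f' := F') (a := 0) (b := ξ₁)
      (C := Real.exp α / 2) (fun x _ => (hFd x).hasDerivWithinAt)
      (fun x hx => hF'lb x ⟨hx.1, hx.2.le⟩) s hs
    rw [hF0, Real.norm_eq_abs, sub_zero] at this
    have h2 := (abs_le.1 this).1
    have h3 : Real.exp α / 2 * s ≤ 1 / 2 := by nlinarith [hs.2]
    linarith
  have hF'ub : ∀ s ∈ Icc 0 ξ₁, F' s ≤ -((Real.exp α / 2 - 1) / 4) := by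
    intro s hs
    rw [hF' s ⟨hs.1, hs.2.trans h1Z⟩]
    unfold profileSlope
    rw [neg_le_neg_iff]
    have h1 : ∫ θ in (0:ℝ)..1, (Real.exp α / 2 - 1) / 4 = (Real.exp α / 2 - 1) / 4 := by simp
    rw [← h1]
    refine intervalIntegral.integral_mono_on zero_le_one (by simp)
      (Continuous.intervalIntegrable (by fun_prop) _ _) fun θ hθ => ?_
    have h2 : θ * s ∈ Icc 0 ξ₁ :=
      ⟨mul_nonneg hθ.1 hs.1, by nlinarith [hθ.2, hs.1, hs.2]⟩
    have a1 : 1 ≤ Real.exp ((1 - θ) * s / 4) := by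
      apply Real.one_le_exp
      have := mul_nonneg (sub_nonneg.2 hθ.2) hs.1
      linarith
    have a2 : (Real.exp α / 2 - 1) / 4 ≤ truncReaction α (F (θ * s)) := by
      unfold truncReaction
      have b1 : Real.exp (α - 1 / 2) ≤ Real.exp (min (F (θ * s)) α) :=
        Real.exp_le_exp.2 (le_min (hFlb _ h2) (by linarith))
      have b2 : Real.exp (α - 1 / 2) = Real.exp α * Real.exp (-(1 / 2)) := by
        rw [← Real.exp_add]; congr 1
      have b3 := Real.add_one_le_exp (-(1 / 2) : ℝ)
      have b4 := Real.exp_pos α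
      nlinarith
    nlinarith
  have hF0' : 4 * F' 0 = 1 - Real.exp α := by
    rw [hF' 0 ⟨le_rfl, by linarith⟩]
    unfold profileSlope truncReaction
    simp [hF0]
    ring
  have hp1 : 1 / 10 ≤ -(ξ₁ * F' ξ₁) := by
    have := hF'ub ξ₁ ⟨hξ₁0.le, le_rfl⟩
    nlinarith
  have hanti1 : StrictAntiOn F (Icc 0 ξ₁) := by
    refine strictAntiOn_of_deriv_neg (convex_Icc _ _) hFc.continuousOn fun x hx => ?_
    rw [(hFd x).deriv]
    have := hF'ub x (interior_subset hx)
    linarith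
  have hFle1 : ∀ s ∈ Icc 0 ξ₁, F s ≤ α := by
    intro s hs
    rw [← hF0]
    exact hanti1.antitoneOn ⟨le_rfl, hξ₁0.le⟩ hs hs.1
  have hF1 : F ξ₁ < α := by
    rw [← hF0]
    exact hanti1 ⟨le_rfl, hξ₁0.le⟩ ⟨hξ₁0.le, le_rfl⟩ hξ₁0
  have hpc : Continuous fun ξ => -(ξ * F' ξ) := by fun_prop
  have hbound : ∀ Y, Y ≤ Z → (∀ s ∈ Icc 0 Y, F s ≤ α) →
      (∀ ξ, ξ₁ ≤ ξ → ξ ≤ ξ₃ → ξ ≤ Y → 1 / 10 + 1 / 80 * Real.log (ξ / ξ₁) ≤ -(ξ * F' ξ)) ∧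
      ∀ ξ, ξ₃ ≤ ξ → ξ ≤ Y → 3 / 2 ≤ -(ξ * F' ξ) := by
    intro Y hY hle
    refine flux_lower_bound hξ₁0 hlog h13 hs3 (F := F) ?_ hFc hpc (by simp) ?_ hp1
    · intro ξ h0 _
      refine (hFd ξ).congr_deriv ?_
      field_simp
    · intro ξ h0 h1
      have := hflux ξ h0 (h1.trans_le hY)
      unfold truncReaction at this
      rwa [min_eq_left (hle ξ ⟨h0.le, h1.le⟩)] at this
  have hbound' : ∀ Y, Y ≤ Z → (∀ s ∈ Icc 0 Y, F s ≤ α) →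
      ∀ ξ, ξ₁ ≤ ξ → ξ ≤ Y → 1 / 10 ≤ -(ξ * F' ξ) := by
    intro Y hY hle ξ h1 h2
    obtain ⟨k1, k2⟩ := hbound Y hY hle
    rcases le_total ξ ξ₃ with h | h
    · have := k1 ξ h1 h h2
      have hlog0 : 0 ≤ Real.log (ξ / ξ₁) := Real.log_nonneg ((one_le_div hξ₁0).2 h1)
      linarith
    · have := k2 ξ h h2
      linarith
  have hFle : ∀ s ∈ Icc 0 Z, F s ≤ α := by
    by_contra hcon
    push Not at hcon
    obtain ⟨s₀, hs₀, hgt⟩ := hcon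
    have hs1 : ξ₁ ≤ s₀ := by
      by_contra h
      exact absurd (hFle1 s₀ ⟨hs₀.1, (not_le.1 h).le⟩) (not_le.2 hgt)
    have hcomp : IsCompact (Icc ξ₁ s₀ ∩ {x | α ≤ F x}) :=
      isCompact_Icc.inter_right (isClosed_le continuous_const hFc)
    obtain ⟨m, ⟨hm1, hm2⟩, hmin⟩ := hcomp.exists_isLeast ⟨s₀, ⟨hs1, le_rfl⟩, hgt.le⟩
    have hm2' : α ≤ F m := hm2
    have hlt : ∀ x, 0 ≤ x → x < m → F x ≤ α := by
      intro x h0 hx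
      rcases le_total x ξ₁ with h | h
      · exact hFle1 x ⟨h0, h⟩
      · by_contra h'
        exact absurd (hmin ⟨⟨h, hx.le.trans hm1.2⟩, (not_le.1 h').le⟩) (not_le.2 hx)
    have hm0 : 0 < m := hξ₁0.trans_le hm1.1
    have hmle : F m ≤ α := by
      have : Tendsto F (𝓝[<] m) (𝓝 (F m)) := hFc.continuousAt.tendsto.mono_left nhdsWithin_le_nhds
      refine le_of_tendsto this ?_
      filter_upwards [Ioo_mem_nhdsLT hm0] with x hx using hlt x hx.1.le hx.2
    have hle : ∀ s ∈ Icc 0 m, F s ≤ α := by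
      intro s hs
      rcases eq_or_lt_of_le hs.2 with h | h
      · rwa [h]
      · exact hlt s hs.1 h
    have hb := hbound' m (hm1.2.trans hs₀.2) hle
    have hanti : StrictAntiOn F (Icc ξ₁ m) := by
      refine strictAntiOn_of_deriv_neg (convex_Icc _ _) hFc.continuousOn fun x hx => ?_
      have hx' := interior_subset hx
      rw [(hFd x).deriv]
      have := hb x hx'.1 hx'.2
      by_contra h
      have := mul_nonneg (hξ₁0.le.trans hx'.1) (not_lt.1 h)
      linarith
    have := hanti.antitoneOn ⟨le_rfl, hm1.1⟩ ⟨hm1.1, le_rfl⟩ hm1.1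
    linarith
  have hb1 := hbound' Z le_rfl hFle
  have hb3 := (hbound Z le_rfl hFle).2
  have hlogmono : ∀ k lo : ℝ, 0 < lo → (∀ ξ, lo ≤ ξ → ξ ≤ Z → k ≤ -(ξ * F' ξ)) →
      AntitoneOn (fun x => F x + k * Real.log x) (Icc lo Z) := by
    intro k lo hlo h
    have hd : ∀ x ∈ Icc lo Z,
        HasDerivAt (fun x => F x + k * Real.log x) (F' x + k * x⁻¹) x := fun x hx =>
      (hFd x).add ((Real.hasDerivAt_log (hlo.trans_le hx.1).ne').const_mul k)
    refine antitoneOn_of_deriv_nonpos (convex_Icc _ _)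
      (fun x hx => (hd x hx).continuousAt.continuousWithinAt)
      (fun x hx => (hd x (interior_subset hx)).differentiableAt.differentiableWithinAt)
      fun x hx => ?_
    have hx' := interior_subset hx
    rw [(hd x hx').deriv]
    have hx0 := hlo.trans_le hx'.1
    have h1 := h x hx'.1 hx'.2
    have h2 : F' x + k * x⁻¹ = (x * F' x + k) * x⁻¹ := by field_simp
    rw [h2]
    exact mul_nonpos_of_nonpos_of_nonneg (by linarith) (inv_pos.2 hx0).le
  refine ⟨F, F', hF'c, hFd, hF0, hF0', ?_, fun ξ h0 h1 => hFle ξ ⟨h0, h1⟩, ?_, ?_⟩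
  · intro ξ h0 h1
    have hd := ((hflux ξ h0 h1).neg).mul (hasDerivAt_inv h0.ne')
    refine ⟨_, hd.congr_of_eventuallyEq ?_, ?_⟩
    · filter_upwards [lt_mem_nhds h0] with x hx
      have : x ≠ 0 := ne_of_gt hx
      simp
      field_simp
    · unfold truncReaction
      rw [min_eq_left (hFle ξ ⟨h0.le, h1.le⟩)]
      simp
      field_simp
      ring
  · intro a b h0 hab hbZ hFa
    have ha : ξ₁ ≤ a := by
      by_contra h
      have := hFlb a ⟨h0, (not_le.1 h).le⟩
      linarith
    have := hlogmono (1 / 10) ξ₁ hξ₁0 hb1 ⟨ha, hab.trans hbZ⟩ ⟨ha.trans hab, hbZ⟩ hab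
    simp only at this
    linarith
  · intro ξ h1 h2
    have := hlogmono (3 / 2) ξ₃ hξ₃0 hb3 ⟨le_rfl, h1.trans h2⟩ ⟨h1, h2⟩ h1
    simp only at this
    rw [hξ₃, Real.log_exp] at this
    have h3 := hFle (Real.exp (112 - α)) ⟨hξ₃0.le, h1.trans h2⟩
    linarith

/-- `u` solves `u_t = Δu + e^u` at the point `(t, x)`. -/
def SolvesAt {N : ℕ} (u : ℝ → Euc N → ℝ) (t : ℝ) (x : Euc N) : Prop :=
  ∃ L, HasDerivAt (fun s => u s x) (L + Real.exp (u t x)) t ∧ HasLap (u t) x L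

theorem SolvesAt.exists_deriv_sub_le {N : ℕ} {u v : ℝ → Euc N → ℝ} {t B c : ℝ} {x : Euc N}
    (hu : SolvesAt u t x) (hv : SolvesAt v t x) (hB : u t x ≤ B) (hc : Real.exp B ≤ c)
    (hpos : 0 < u t x - v t x) :
    ∃ f', HasDerivAt (fun s => u s x - v s x) f' t ∧
      (IsLocalMax (fun y => u t y - v t y) x → f' ≤ c * (u t x - v t x)) := by
  obtain ⟨L, hL, hl⟩ := hu
  obtain ⟨M, hM, hm⟩ := hv
  refine ⟨_, hL.sub hM, fun hmax => ?_⟩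
  have h1 := (hl.sub hm).nonpos_of_isLocalMax hmax
  have h2 := exp_sub_exp_le (u t x) (v t x)
  have h3 : Real.exp (u t x) * (u t x - v t x) ≤ c * (u t x - v t x) :=
    mul_le_mul_of_nonneg_right ((Real.exp_le_exp.2 hB).trans hc) hpos.le
  linarith

/-- The solution with backward self-similar profile `F` that blows up at time `S`. -/
def selfSimilar (F : ℝ → ℝ) (S t : ℝ) (x : Euc 2) : ℝ :=
  -Real.log (S - t) + F (‖x‖ ^ 2 / (S - t))

theorem continuousOn_selfSimilar {F : ℝ → ℝ} (hF : Continuous F) (S : ℝ) :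
    ContinuousOn (fun p : ℝ × Euc 2 => selfSimilar F S p.1 p.2) (Iio S ×ˢ univ) := by
  have h0 : ∀ p ∈ Iio S ×ˢ (univ : Set (Euc 2)), S - p.1 ≠ 0 := by
    intro p hp
    have : p.1 < S := hp.1
    linarith
  refine ContinuousOn.add (ContinuousOn.neg (ContinuousOn.log (by fun_prop) h0)) ?_
  exact hF.comp_continuousOn (ContinuousOn.div (by fun_prop) (by fun_prop) h0)

theorem solvesAt_selfSimilar {F F' : ℝ → ℝ} {α Z S t : ℝ} {x : Euc 2} (hc : Continuous F')
    (hF : ∀ ξ, HasDerivAt F (F' ξ) ξ) (hF0 : F 0 = α) (hF'0 : 4 * F' 0 = 1 - Real.exp α)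
    (hode : ∀ ξ, 0 < ξ → ξ < Z → ∃ a, HasDerivAt F' a ξ ∧
      4 * ξ * a + 4 * F' ξ - ξ * F' ξ + Real.exp (F ξ) - 1 = 0)
    (ht : t < S) (hx : ‖x‖ ^ 2 / (S - t) < Z) : SolvesAt (selfSimilar F S) t x := by
  have hτ : 0 < S - t := by linarith
  have hτ' : S - t ≠ 0 := hτ.ne'
  set τ := S - t with hτdef
  have hexp : Real.exp (selfSimilar F S t x) = Real.exp (F (‖x‖ ^ 2 / τ)) / τ := by
    rw [selfSimilar, ← hτdef, Real.exp_add, Real.exp_neg, Real.exp_log hτ]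
    field_simp
  have hsub : HasDerivAt (fun s => S - s) (-1) t := by
    simpa using (hasDerivAt_id t).const_sub S
  have htime : HasDerivAt (fun s => selfSimilar F S s x)
      ((1 + ‖x‖ ^ 2 / τ * F' (‖x‖ ^ 2 / τ)) / τ) t := by
    have h1 := (hsub.log hτ').neg
    have h2 : HasDerivAt (fun s => ‖x‖ ^ 2 / (S - s)) (‖x‖ ^ 2 / τ ^ 2) t := by
      refine ((hasDerivAt_const t (‖x‖ ^ 2)).div hsub hτ').congr_deriv ?_
      simp [hτdef]
    have h3 := (hF (‖x‖ ^ 2 / τ)).comp t h2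
    refine (h1.add h3).congr_deriv ?_
    rw [← hτdef]
    field_simp
  have hΦ : ∀ ξ, HasDerivAt (fun ξ => -Real.log τ + F (ξ / τ)) (F' (ξ / τ) / τ) ξ := by
    intro ξ
    have h2 : HasDerivAt (fun ξ : ℝ => ξ / τ) (1 / τ) ξ := (hasDerivAt_id ξ).div_const τ
    refine (((hF (ξ / τ)).comp ξ h2).const_add (-Real.log τ)).congr_deriv ?_
    ring
  have hΦc : Continuous fun ξ => F' (ξ / τ) / τ := by fun_prop
  by_cases hx0 : x = 0
  · have hlap := hasLap_radial (x := x) (a := 0) hΦ hΦc (fun h => absurd hx0 h)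
    refine ⟨_, ?_, hlap⟩
    refine htime.congr_deriv ?_
    rw [hexp]
    subst hx0
    simp only [norm_zero, ne_eq, OfNat.ofNat_ne_zero, not_false_eq_true, zero_pow, zero_div, hF0]
    field_simp
    push_cast
    linarith
  · have hξ : 0 < ‖x‖ ^ 2 / τ := by
      have := norm_pos_iff.2 hx0
      positivity
    obtain ⟨a, ha, hode⟩ := hode _ hξ hx
    have h2 : HasDerivAt (fun ξ : ℝ => ξ / τ) (1 / τ) (‖x‖ ^ 2) :=
      (hasDerivAt_id (‖x‖ ^ 2)).div_const τ
    have h3 := HasDerivAt.comp (h₂ := F') (h := fun ξ : ℝ => ξ / τ) (‖x‖ ^ 2) ha h2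
    have hlap := hasLap_radial (x := x) hΦ hΦc (fun _ => h3.div_const τ)
    refine ⟨_, ?_, hlap⟩
    refine htime.congr_deriv ?_
    rw [hexp]
    have e : 4 * ‖x‖ ^ 2 * (a * (1 / τ) / τ) = 4 * (‖x‖ ^ 2 / τ) * a / τ := by
      field_simp
    rw [e]
    have : 4 * (‖x‖ ^ 2 / τ) * a + 4 * F' (‖x‖ ^ 2 / τ) + Real.exp (F (‖x‖ ^ 2 / τ)) =
      1 + ‖x‖ ^ 2 / τ * F' (‖x‖ ^ 2 / τ) := by linarith
    rw [← this]
    push_cast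
    ring

/-- Comparison at the origin with a steep self-similar solution. -/
theorem center_le_of_lipschitz {u : ℝ → Euc 2 → ℝ} {Ω : Set (Euc 2)} {T S t₀ δ α : ℝ}
    (hδ : 0 < δ) (hball : closedBall 0 δ ⊆ Ω) (ht₀ : 0 < t₀) (hS : t₀ < S) (hST : S < T)
    (hcont : ContinuousOn (fun p : ℝ × Euc 2 => u p.1 p.2) (Ico 0 T ×ˢ Ω))
    (hsol : ∀ t ∈ Ioo 0 T, ∀ x ∈ Ω, SolvesAt u t x)
    (hrad : ∀ t, RadiallySymmetric (u t))
    (hmax : ∀ t ∈ Ioo (0:ℝ) T, ∀ x ∈ Ω, u t x ≤ u t 0)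
    (hnonneg : ∀ t ∈ Ioo (0:ℝ) T, ∀ x ∈ Ω, 0 ≤ u t x)
    (hα : 132 ≤ α) (hα₁ : u t₀ 0 + Real.log (S - t₀) < α - 1 / 2)
    (hα₂ : Real.log (S - t₀) - 3 * Real.log (δ ^ 2) + 336 ≤ α)
    (hα₃ : Real.exp (112 - α) * (S - t₀) ≤ δ ^ 2)
    (hlip : ∀ x ∈ closedBall (0 : Euc 2) δ, ∀ y ∈ closedBall (0 : Euc 2) δ,
      u t₀ x - u t₀ y ≤ 1 / (5 * δ) * ‖x - y‖) :
    ∀ t₁ ∈ Ico t₀ S, u t₁ 0 ≤ α - Real.log (S - t₁) := by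
  intro t₁ ht₁
  by_contra hcon
  push Not at hcon
  have h0Ω : (0 : Euc 2) ∈ Ω := hball (by simp [hδ.le])
  obtain ⟨B, hB⟩ : ∃ B, ∀ t ∈ Icc t₀ S, u t 0 ≤ B := by
    have hc : ContinuousOn (fun t => u t 0) (Icc t₀ S) :=
      hcont.comp (f := fun t : ℝ => (t, (0 : Euc 2))) (by fun_prop)
        (fun t ht => ⟨⟨by linarith [ht.1], by linarith [ht.2]⟩, h0Ω⟩)
    obtain ⟨B, hB⟩ := (isCompact_Icc.image_of_continuousOn hc).bddAbove
    exact ⟨B, fun t ht => hB (mem_image_of_mem _ ht)⟩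
  obtain ⟨t₂, h12, h2S, ht₂⟩ : ∃ t₂, t₁ < t₂ ∧ t₂ < S ∧ u t₂ 0 < α - Real.log (S - t₂) := by
    have hm : 0 < min ((S - t₁) / 2) (Real.exp (α - B - 1)) :=
      lt_min (by linarith [ht₁.2]) (Real.exp_pos _)
    have hm1 : min ((S - t₁) / 2) (Real.exp (α - B - 1)) ≤ (S - t₁) / 2 := min_le_left _ _
    refine ⟨S - min ((S - t₁) / 2) (Real.exp (α - B - 1)), by linarith [ht₁.2], by linarith, ?_⟩
    have h1 := hB (S - min ((S - t₁) / 2) (Real.exp (α - B - 1)))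
      ⟨by linarith [ht₁.1, ht₁.2], by linarith⟩
    have h2 := Real.log_le_log hm (min_le_right _ _)
    rw [Real.log_exp] at h2
    rw [sub_sub_cancel]
    linarith
  set Z : ℝ := max 1 (δ ^ 2 / (S - t₂) + 1) with hZ
  obtain ⟨F, F', hF'c, hF, hF0, hF'0, hode, hFα, hFlog, hFdecay⟩ :=
    exists_steep_profile hα (le_max_left _ _ : 1 ≤ Z)
  have hFc : Continuous F := continuous_iff_continuousAt.2 fun ξ => (hF ξ).continuousAt
  set v : ℝ → Euc 2 → ℝ := selfSimilar F S with hv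
  have hτ : ∀ t, t ≤ t₂ → 0 < S - t := fun t ht => by linarith
  have hsq : ∀ {x : Euc 2} {r : ℝ}, ‖x‖ ≤ r → ‖x‖ ^ 2 ≤ r ^ 2 := fun h =>
    pow_le_pow_left₀ (norm_nonneg _) h 2
  have hξZ : ∀ t, t ≤ t₂ → ∀ x : Euc 2, ‖x‖ ≤ δ → ‖x‖ ^ 2 / (S - t) < Z := by
    intro t ht x hx
    have : ‖x‖ ^ 2 / (S - t) ≤ δ ^ 2 / (S - t₂) :=
      div_le_div₀ (by positivity) (hsq hx) (hτ t₂ le_rfl) (by linarith)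
    have h2 : δ ^ 2 / (S - t₂) + 1 ≤ Z := le_max_right _ _
    linarith
  have hξ0 : ∀ t, t ≤ t₂ → ∀ x : Euc 2, 0 ≤ ‖x‖ ^ 2 / (S - t) := fun t ht x =>
    div_nonneg (by positivity) (hτ t ht).le
  have hvsol : ∀ t, t ≤ t₂ → ∀ x : Euc 2, ‖x‖ ≤ δ → SolvesAt v t x := fun t ht x hx =>
    solvesAt_selfSimilar hF'c hF hF0 hF'0 hode (by linarith) (hξZ t ht x hx)
  have hv0 : ∀ t, v t 0 = α - Real.log (S - t) := by
    intro t
    simp [hv, selfSimilar, hF0]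
    ring
  set M : ℝ := max B (α - Real.log (S - t₂)) with hM
  have hvM : ∀ t, t ≤ t₂ → ∀ x : Euc 2, ‖x‖ ≤ δ → v t x ≤ M := by
    intro t ht x hx
    have h1 := hFα _ (hξ0 t ht x) (hξZ t ht x hx).le
    have h2 := Real.log_le_log (hτ t₂ le_rfl) (by linarith : S - t₂ ≤ S - t)
    refine le_trans ?_ (le_max_right _ _)
    simp only [hv, selfSimilar]
    linarith
  have huM : ∀ t, t₀ ≤ t → t ≤ t₂ → ∀ x : Euc 2, ‖x‖ ≤ δ → u t x ≤ M := by
    intro t h0 ht x hx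
    refine le_trans ?_ (le_max_left _ _)
    exact (hmax t ⟨by linarith, by linarith⟩ x (hball (by simpa using hx))).trans
      (hB t ⟨h0, by linarith⟩)
  have husol : ∀ t, t₀ ≤ t → t ≤ t₂ → ∀ x : Euc 2, ‖x‖ ≤ δ → SolvesAt u t x :=
    fun t h0 ht x hx => hsol t ⟨by linarith, by linarith⟩ x (hball (by simpa using hx))
  have hvb : ∀ t, t₀ ≤ t → t ≤ t₂ → ∀ x : Euc 2, ‖x‖ = δ → v t x ≤ u t x := by
    intro t h0 ht x hx
    have hu0 := hnonneg t ⟨by linarith, by linarith⟩ x (hball (by simpa using hx.le))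
    have h1 : Real.exp (112 - α) ≤ ‖x‖ ^ 2 / (S - t) := by
      rw [le_div_iff₀ (hτ t ht), hx]
      exact (mul_le_mul_of_nonneg_left (by linarith) (Real.exp_pos _).le).trans hα₃
    have h2 := hFdecay _ h1 (hξZ t ht x hx.le).le
    have h3 : Real.log (‖x‖ ^ 2 / (S - t)) = Real.log (δ ^ 2) - Real.log (S - t) := by
      rw [hx, Real.log_div (by positivity) (hτ t ht).ne']
    have h4 := Real.log_le_log (hτ t ht) (by linarith : S - t ≤ S - t₀)
    rw [h3] at h2
    simp only [hv, selfSimilar]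
    linarith
  have huc : ContinuousOn (fun p : ℝ × Euc 2 => u p.1 p.2) (Icc t₀ t₂ ×ˢ closedBall 0 δ) :=
    hcont.mono (prod_mono (fun t ht => ⟨by linarith [ht.1], by linarith [ht.2]⟩) hball)
  have hvc : ContinuousOn (fun p : ℝ × Euc 2 => v p.1 p.2) (Icc t₀ t₂ ×ˢ closedBall 0 δ) :=
    (continuousOn_selfSimilar hFc S).mono
      (prod_mono (fun t ht => lt_of_le_of_lt ht.2 h2S) (subset_univ _))
  have hinit : ∀ x y : Euc 2, ‖x‖ < ‖y‖ → ‖y‖ ≤ δ → v t₀ x < u t₀ x → v t₀ y ≤ u t₀ y := by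
    intro x y hxy hy hx
    by_contra hvy
    push Not at hvy
    have hle : t₀ ≤ t₂ := by linarith [ht₁.1]
    have hxΩ : x ∈ Ω := hball (by simpa using hxy.le.trans hy)
    have hτ₀ := hτ t₀ hle
    have hFx : F (‖x‖ ^ 2 / (S - t₀)) < α - 1 / 2 := by
      have := hmax t₀ ⟨ht₀, by linarith⟩ x hxΩ
      simp only [hv, selfSimilar] at hx
      linarith
    have hx0 : 0 < ‖x‖ := by
      rw [norm_pos_iff]
      rintro rfl
      simp [hF0] at hFx
      linarith
    have hy0 : 0 < ‖y‖ := hx0.trans hxy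
    have h1 := hFlog _ (‖y‖ ^ 2 / (S - t₀)) (hξ0 t₀ hle x)
      (div_le_div_of_nonneg_right (hsq hxy.le) hτ₀.le) (hξZ t₀ hle y hy).le hFx
    rw [Real.log_div (by positivity) hτ₀.ne', Real.log_div (by positivity) hτ₀.ne',
      Real.log_pow, Real.log_pow] at h1
    have h2 : (‖y‖ - ‖x‖) / δ ≤ Real.log ‖y‖ - Real.log ‖x‖ := by
      have h3 := Real.log_le_sub_one_of_pos (div_pos hx0 hy0)
      rw [Real.log_div hx0.ne' hy0.ne'] at h3
      have h4 : (‖y‖ - ‖x‖) / δ ≤ (‖y‖ - ‖x‖) / ‖y‖ :=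
        div_le_div_of_nonneg_left (by linarith) hy0 hy
      have h5 : (‖y‖ - ‖x‖) / ‖y‖ = 1 - ‖x‖ / ‖y‖ := by field_simp
      linarith
    have hz : ‖(‖x‖ / ‖y‖) • y‖ = ‖x‖ := by
      rw [norm_smul, Real.norm_of_nonneg (by positivity)]
      field_simp
    have h6 := hlip ((‖x‖ / ‖y‖) • y) (by simpa [hz] using hxy.le.trans hy) y (by simpa using hy)
    have h7 : ‖(‖x‖ / ‖y‖) • y - y‖ = ‖y‖ - ‖x‖ := by
      have : (‖x‖ / ‖y‖) • y - y = (‖x‖ / ‖y‖ - 1) • y := by rw [sub_smul, one_smul]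
      have h8 : ‖x‖ / ‖y‖ - 1 ≤ 0 := by
        rw [sub_nonpos, div_le_one hy0]
        exact hxy.le
      rw [this, norm_smul, Real.norm_of_nonpos h8]
      field_simp
      ring
    rw [h7, hrad t₀ _ x hz] at h6
    have h9 : 1 / (5 * δ) * (‖y‖ - ‖x‖) = 1 / 5 * ((‖y‖ - ‖x‖) / δ) := by field_simp
    simp only [hv, selfSimilar] at hx hvy
    push_cast at h1
    linarith
  have hvrad : ∀ t (x y : Euc 2), ‖x‖ = ‖y‖ → v t x = v t y := by
    intro t x y h
    simp [hv, selfSimilar, h]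
  have hstep : ∀ y : Euc 2, ‖y‖ ≤ δ → v t₁ y ≤ u t₁ y := by
    intro y hy
    set K : Set (ℝ × Euc 2 × Euc 2) :=
      {p | p.1 ∈ Icc t₀ t₁ ∧ ‖p.2.1‖ ≤ ‖p.2.2‖ ∧ ‖p.2.2‖ ≤ δ} with hK
    have hKc : IsCompact K := by
      refine ((isCompact_Icc (a := t₀) (b := t₁)).prod ((isCompact_closedBall (0 : Euc 2) δ).prod
        (isCompact_closedBall (0 : Euc 2) δ))).of_isClosed_subset ?_ ?_
      · have h1 : IsClosed {p : ℝ × Euc 2 × Euc 2 | ‖p.2.1‖ ≤ ‖p.2.2‖} :=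
          isClosed_le (by fun_prop) (by fun_prop)
        have h2 : IsClosed {p : ℝ × Euc 2 × Euc 2 | ‖p.2.2‖ ≤ δ} :=
          isClosed_le (by fun_prop) (by fun_prop)
        exact (isClosed_Icc.preimage continuous_fst).inter (h1.inter h2)
      · rintro ⟨t, x, y⟩ ⟨h1, h2, h3⟩
        exact ⟨h1, by simpa using h2.trans h3, by simpa using h3⟩
    have hmaps₁ : MapsTo (fun p : ℝ × Euc 2 × Euc 2 => (p.1, p.2.1)) K
        (Icc t₀ t₂ ×ˢ closedBall 0 δ) := by
      rintro ⟨t, x, y⟩ ⟨h1, h2, h3⟩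
      exact ⟨⟨h1.1, h1.2.trans h12.le⟩, by simpa using h2.trans h3⟩
    have hmaps₂ : MapsTo (fun p : ℝ × Euc 2 × Euc 2 => (p.1, p.2.2)) K
        (Icc t₀ t₂ ×ˢ closedBall 0 δ) := by
      rintro ⟨t, x, y⟩ ⟨h1, h2, h3⟩
      exact ⟨⟨h1.1, h1.2.trans h12.le⟩, by simpa using h3⟩
    have hcomp := not_pos_of_two_point K hKc (fun t x => u t x - v t x) (fun t y => v t y - u t y)
      (Real.exp M)
      ((huc.sub hvc).comp (f := fun p : ℝ × Euc 2 × Euc 2 => (p.1, p.2.1)) (by fun_prop) hmaps₁)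
      ((hvc.sub huc).comp (f := fun p : ℝ × Euc 2 × Euc 2 => (p.1, p.2.2)) (by fun_prop) hmaps₂)
      ?_ ?_ ?_ t₁ 0 y ⟨⟨ht₁.1, le_rfl⟩, by simp, hy⟩ ?_
    · linarith
    · rintro t x y ⟨⟨h1, h1'⟩, h2, h3⟩ hf hg
      dsimp only at h1 h1' h2 h3
      have hne : ‖x‖ ≠ ‖y‖ := by
        intro h
        rw [hvrad t x y h, hrad t x y h] at hf
        linarith
      have hlt : ‖x‖ < ‖y‖ := lt_of_le_of_ne h2 hne
      have hyδ : ‖y‖ < δ := by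
        refine lt_of_le_of_ne h3 fun h => ?_
        have := hvb t h1 (by linarith) y h
        linarith
      have ht : t₀ < t := by
        refine lt_of_le_of_ne h1 ?_
        rintro rfl
        have := hinit x y hlt h3 (by linarith)
        linarith
      refine ⟨?_, ?_, ?_⟩
      · filter_upwards [(continuous_norm.tendsto x).eventually (gt_mem_nhds hlt)] with x' hx'
        exact ⟨⟨h1, h1'⟩, hx'.le, h3⟩
      · filter_upwards [(continuous_norm.tendsto y).eventually (gt_mem_nhds hyδ),
          (continuous_norm.tendsto y).eventually (lt_mem_nhds hlt)] with y' hy' hy''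
        exact ⟨⟨h1, h1'⟩, hy''.le, hy'.le⟩
      · filter_upwards [Ioo_mem_nhdsLT ht] with s hs
        exact ⟨⟨hs.1.le, hs.2.le.trans h1'⟩, h2, h3⟩
    · rintro t x y ⟨⟨h1, h1'⟩, h2, h3⟩ hf hg
      dsimp only at h1 h1' h2 h3
      exact (husol t h1 (by linarith) x (h2.trans h3)).exists_deriv_sub_le
        (hvsol t (by linarith) x (h2.trans h3)) (huM t h1 (by linarith) x (h2.trans h3)) le_rfl hf
    · rintro t x y ⟨⟨h1, h1'⟩, h2, h3⟩ hf hg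
      dsimp only at h1 h1' h2 h3
      exact (hvsol t (by linarith) y h3).exists_deriv_sub_le
        (husol t h1 (by linarith) y h3) (hvM t (by linarith) y h3) le_rfl hg
    · rw [hv0]
      linarith
  set K : Set (ℝ × Euc 2 × Unit) := Icc t₁ t₂ ×ˢ (closedBall 0 δ ×ˢ univ) with hK
  have hKc : IsCompact K := isCompact_Icc.prod ((isCompact_closedBall _ _).prod isCompact_univ)
  have hmaps : MapsTo (fun p : ℝ × Euc 2 × Unit => (p.1, p.2.1)) K
      (Icc t₀ t₂ ×ˢ closedBall 0 δ) := by
    rintro ⟨t, x, y⟩ ⟨h1, h2, h3⟩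
    exact ⟨⟨ht₁.1.trans h1.1, h1.2⟩, h2⟩
  refine not_pos_of_two_point K hKc (fun t x => v t x - u t x) (fun _ _ => 1) (Real.exp M)
    ((hvc.sub huc).comp (f := fun p : ℝ × Euc 2 × Unit => (p.1, p.2.1)) (by fun_prop) hmaps)
    continuousOn_const ?_ ?_ ?_ t₂ 0 () ⟨⟨h12.le, le_rfl⟩, by simp [hδ.le], trivial⟩ ?_ one_pos
  · rintro t x y ⟨⟨h1, h1'⟩, h2, h3⟩ hf hg
    dsimp only at h1 h1' h2 h3
    rw [mem_closedBall_zero_iff] at h2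
    have hxδ : ‖x‖ < δ := by
      refine lt_of_le_of_ne h2 fun h => ?_
      have := hvb t (ht₁.1.trans h1) h1' x h
      linarith
    have ht : t₁ < t := by
      refine lt_of_le_of_ne h1 ?_
      rintro rfl
      have := hstep x h2
      linarith
    refine ⟨?_, Eventually.of_forall fun y' => ⟨⟨h1, h1'⟩, by simpa using h2, trivial⟩, ?_⟩
    · filter_upwards [(continuous_norm.tendsto x).eventually (gt_mem_nhds hxδ)] with x' hx'
      exact ⟨⟨h1, h1'⟩, by simpa using hx'.le, trivial⟩
    · filter_upwards [Ioo_mem_nhdsLT ht] with s hs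
      exact ⟨⟨hs.1.le, hs.2.le.trans h1'⟩, by simpa using h2, trivial⟩
  · rintro t x y ⟨⟨h1, h1'⟩, h2, h3⟩ hf hg
    dsimp only at h1 h1' h2 h3
    rw [mem_closedBall_zero_iff] at h2
    exact (hvsol t h1' x h2).exists_deriv_sub_le
      (husol t (ht₁.1.trans h1) h1' x h2) (hvM t h1' x h2) le_rfl hf
  · intro t x y _ _ _
    exact ⟨0, hasDerivAt_const _ _, fun _ => by positivity⟩
  · rw [hv0]
    linarith

/-- The upper half of the type I estimate at the origin. -/
theorem exists_log_add_center_le {u : ℝ → Euc 2 → ℝ} {Ω : Set (Euc 2)} {T : ℝ} (hT : 0 < T)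
    (hΩ : IsOpen Ω) (h0Ω : (0 : Euc 2) ∈ Ω)
    (hcont : ContinuousOn (fun p : ℝ × Euc 2 => u p.1 p.2) (Ico 0 T ×ˢ Ω))
    (hdiff : ∀ t ∈ Ioo 0 T, ContDiffAt ℝ 1 (u t) 0)
    (hsol : ∀ t ∈ Ioo 0 T, ∀ x ∈ Ω, SolvesAt u t x)
    (hrad : ∀ t, RadiallySymmetric (u t))
    (hmax : ∀ t ∈ Ioo (0:ℝ) T, ∀ x ∈ Ω, u t x ≤ u t 0)
    (hnonneg : ∀ t ∈ Ioo (0:ℝ) T, ∀ x ∈ Ω, 0 ≤ u t x) :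
    ∃ C, ∀ t ∈ Ioo (0:ℝ) T, Real.log (T - t) + u t 0 ≤ C := by
  set t₀ : ℝ := T / 2 with ht₀
  have ht₀pos : 0 < t₀ := by positivity
  have ht₀T : t₀ < T := half_lt_self hT
  obtain ⟨L, s, hs, hL⟩ := (hdiff t₀ ⟨ht₀pos, ht₀T⟩).exists_lipschitzOnWith
  obtain ⟨r, hr, hrs⟩ := Metric.nhds_basis_closedBall.mem_iff.1
    (inter_mem hs (hΩ.mem_nhds h0Ω))
  have hL1 : 0 < (L : ℝ) + 1 := by positivity
  set δ : ℝ := min r (1 / (5 * (L + 1))) with hδdef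
  have hδ : 0 < δ := lt_min hr (by positivity)
  have hsub : closedBall (0 : Euc 2) δ ⊆ s ∩ Ω :=
    (closedBall_subset_closedBall (min_le_left _ _)).trans hrs
  have hlip : ∀ x ∈ closedBall (0 : Euc 2) δ, ∀ y ∈ closedBall (0 : Euc 2) δ,
      u t₀ x - u t₀ y ≤ 1 / (5 * δ) * ‖x - y‖ := by
    intro x hx y hy
    have h1 := hL.dist_le_mul x (hsub hx).1 y (hsub hy).1
    rw [Real.dist_eq, dist_eq_norm] at h1
    have h2 : δ ≤ 1 / (5 * (L + 1)) := min_le_right _ _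
    have h3 : (L : ℝ) ≤ 1 / (5 * δ) := by
      rw [le_div_iff₀ (by positivity)] at h2 ⊢
      nlinarith
    exact (le_abs_self _).trans (h1.trans (mul_le_mul_of_nonneg_right h3 (norm_nonneg _)))
  set α : ℝ := max (max 132 (u t₀ 0 + Real.log T + 1))
    (max (Real.log T - 3 * Real.log (δ ^ 2) + 336) (112 - Real.log (δ ^ 2 / T))) with hα
  have hα1 : 132 ≤ α := (le_max_left _ _).trans (le_max_left _ _)
  have hα2 : u t₀ 0 + Real.log T + 1 ≤ α := (le_max_right _ _).trans (le_max_left _ _)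
  have hα3 : Real.log T - 3 * Real.log (δ ^ 2) + 336 ≤ α :=
    (le_max_left _ _).trans (le_max_right _ _)
  have hα4 : 112 - Real.log (δ ^ 2 / T) ≤ α := (le_max_right _ _).trans (le_max_right _ _)
  have hlate : ∀ t ∈ Ico t₀ T, Real.log (T - t) + u t 0 ≤ α := by
    intro t ht
    have hne : T - t ≠ 0 := by linarith [ht.2]
    have hlim : Tendsto (fun S => Real.log (S - t) + u t 0) (𝓝[<] T)
        (𝓝 (Real.log (T - t) + u t 0)) := by
      have : ContinuousAt (fun S => Real.log (S - t) + u t 0) T :=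
        ((continuousAt_id.sub continuousAt_const).log hne).add continuousAt_const
      exact this.tendsto.mono_left nhdsWithin_le_nhds
    refine le_of_tendsto hlim ?_
    filter_upwards [Ioo_mem_nhdsLT ht.2] with S hS
    have hS0 : t₀ < S := ht.1.trans_lt hS.1
    have hlog : Real.log (S - t₀) ≤ Real.log T :=
      Real.log_le_log (by linarith) (by linarith [hS.2])
    have hexp : Real.exp (112 - α) * (S - t₀) ≤ δ ^ 2 := by
      have h1 : Real.exp (112 - α) ≤ δ ^ 2 / T := by
        rw [← Real.le_log_iff_exp_le (by positivity)]
        linarith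
      calc Real.exp (112 - α) * (S - t₀) ≤ δ ^ 2 / T * T := by
            gcongr
            linarith [hS.2]
        _ = δ ^ 2 := by field_simp
    have := center_le_of_lipschitz hδ (hsub.trans inter_subset_right) ht₀pos hS0 hS.2 hcont hsol
      hrad hmax hnonneg hα1 (by linarith) (by linarith) hexp hlip t ⟨ht.1, hS.1⟩
    linarith
  obtain ⟨B, hB⟩ : ∃ B, ∀ t ∈ Icc 0 t₀, u t 0 ≤ B := by
    have hc : ContinuousOn (fun t => u t 0) (Icc 0 t₀) :=
      hcont.comp (f := fun t : ℝ => (t, (0 : Euc 2))) (by fun_prop)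
        (fun t ht => ⟨⟨ht.1, by linarith [ht.2]⟩, h0Ω⟩)
    obtain ⟨B, hB⟩ := (isCompact_Icc.image_of_continuousOn hc).bddAbove
    exact ⟨B, fun t ht => hB (mem_image_of_mem _ ht)⟩
  refine ⟨max α (Real.log T + B), fun t ht => ?_⟩
  rcases le_or_gt t₀ t with h | h
  · exact (hlate t ⟨h, ht.2⟩).trans (le_max_left _ _)
  · refine le_trans (add_le_add ?_ (hB t ⟨ht.1.le, h.le⟩)) (le_max_right _ _)
    exact Real.log_le_log (by linarith [ht.2]) (by linarith [ht.1])

/-- The lower half of the type I estimate at the origin. -/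
theorem zero_le_log_add_center {u : ℝ → Euc 2 → ℝ} {Ω : Set (Euc 2)} {T : ℝ}
    (hΩ : IsOpen Ω) (h0Ω : (0 : Euc 2) ∈ Ω)
    (hsol : ∀ t ∈ Ioo 0 T, ∀ x ∈ Ω, SolvesAt u t x)
    (hmax : ∀ t ∈ Ioo (0:ℝ) T, ∀ x ∈ Ω, u t x ≤ u t 0)
    (hblow : ∀ M : ℝ, ∃ᶠ t in 𝓝[<] T, M < u t 0) :
    ∀ t ∈ Ioo (0:ℝ) T, 0 ≤ Real.log (T - t) + u t 0 := by
  intro t ht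
  have hderiv : ∀ s ∈ Ioo 0 T, ∃ d, HasDerivAt (fun s => Real.exp (-u s 0) + s) d s ∧ 0 ≤ d := by
    intro s hs
    obtain ⟨L, hL, hl⟩ := hsol s hs 0 h0Ω
    refine ⟨_, (hL.neg.exp).add (hasDerivAt_id s), ?_⟩
    have h1 : L ≤ 0 := by
      refine hl.nonpos_of_isLocalMax ?_
      filter_upwards [hΩ.mem_nhds h0Ω] with x hx using hmax s hs x hx
    have h2 : Real.exp (-u s 0) * Real.exp (u s 0) = 1 := by
      rw [← Real.exp_add]
      simp
    have h3 := mul_nonneg (Real.exp_pos (-u s 0)).le (neg_nonneg.2 h1)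
    change 0 ≤ Real.exp (-u s 0) * -(L + Real.exp (u s 0)) + 1
    linarith
  have hmono : MonotoneOn (fun s => Real.exp (-u s 0) + s) (Ioo 0 T) := by
    refine monotoneOn_of_deriv_nonneg (convex_Ioo 0 T) ?_ ?_ ?_
    · intro s hs
      obtain ⟨d, hd, -⟩ := hderiv s hs
      exact hd.continuousAt.continuousWithinAt
    · rw [interior_Ioo]
      intro s hs
      obtain ⟨d, hd, -⟩ := hderiv s hs
      exact hd.differentiableAt.differentiableWithinAt
    · rw [interior_Ioo]
      intro s hs
      obtain ⟨d, hd, hd0⟩ := hderiv s hs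
      rwa [hd.deriv]
  have hle : Real.exp (-u t 0) ≤ T - t := by
    refine le_of_forall_pos_le_add fun ε hε => ?_
    obtain ⟨s, hs, hs'⟩ := ((hblow (-Real.log ε)).and_eventually
      (Ioo_mem_nhdsLT ht.2)).exists
    have h1 := hmono ht ⟨ht.1.trans hs'.1, hs'.2⟩ hs'.1.le
    have h2 : Real.exp (-u s 0) < ε := by
      rw [← Real.lt_log_iff_exp_lt hε]
      linarith
    dsimp only at h1
    linarith [hs'.2]
  rw [← Real.le_log_iff_exp_le (by linarith [ht.2])] at hle
  linarith

theorem supAbs_eq_ofReal {Ω : Set (Euc 2)} {w : Euc 2 → ℝ} (h0Ω : (0 : Euc 2) ∈ Ω)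
    (hmax : ∀ x ∈ Ω, w x ≤ w 0) (hnonneg : ∀ x ∈ Ω, 0 ≤ w x) :
    supAbs Ω w = ENNReal.ofReal (w 0) := by
  refine le_antisymm (iSup₂_le fun x hx => ?_) ?_
  · rw [abs_of_nonneg (hnonneg x hx)]
    exact ENNReal.ofReal_le_ofReal (hmax x hx)
  · refine le_trans ?_ (le_iSup₂ (f := fun x (_ : x ∈ Ω) => ENNReal.ofReal |w x|) 0 h0Ω)
    exact ENNReal.ofReal_le_ofReal (le_abs_self _)

theorem nonneg_of_ball {u : ℝ → Euc 2 → ℝ} {R T : ℝ}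
    (hcont : ContinuousOn (fun p : ℝ × Euc 2 => u p.1 p.2) (Ico 0 T ×ˢ closedBall 0 R))
    (hsol : ∀ t ∈ Ioo 0 T, ∀ x ∈ ball (0 : Euc 2) R, SolvesAt u t x)
    (hbc : ∀ t ∈ Ico 0 T, ∀ x : Euc 2, ‖x‖ = R → u t x = 0)
    (hic : ∀ x ∈ closedBall (0 : Euc 2) R, 0 ≤ u 0 x) :
    ∀ t ∈ Ico 0 T, ∀ x ∈ closedBall (0 : Euc 2) R, 0 ≤ u t x := by
  intro t₁ ht₁ x₁ hx₁
  by_contra hneg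
  push Not at hneg
  set K : Set (ℝ × Euc 2 × Unit) := Icc 0 t₁ ×ˢ (closedBall 0 R ×ˢ univ) with hK
  have hKc : IsCompact K := isCompact_Icc.prod ((isCompact_closedBall _ _).prod isCompact_univ)
  have hmaps : MapsTo (fun p : ℝ × Euc 2 × Unit => (p.1, p.2.1)) K
      (Ico 0 T ×ˢ closedBall 0 R) := by
    rintro ⟨t, x, y⟩ ⟨h1, h2, h3⟩
    exact ⟨⟨h1.1, h1.2.trans_lt ht₁.2⟩, h2⟩
  have hint : ∀ t x, t ∈ Icc 0 t₁ → x ∈ closedBall (0 : Euc 2) R → 0 < -u t x →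
      0 < t ∧ ‖x‖ < R := by
    intro t x ht hx hf
    refine ⟨lt_of_le_of_ne ht.1 ?_, lt_of_le_of_ne (by simpa using hx) fun h => ?_⟩
    · rintro rfl
      linarith [hic x hx]
    · rw [hbc t ⟨ht.1, ht.2.trans_lt ht₁.2⟩ x h] at hf
      simp at hf
  refine not_pos_of_two_point K hKc (fun t x => -u t x) (fun _ _ => 1) 0
    (hcont.neg.comp (f := fun p : ℝ × Euc 2 × Unit => (p.1, p.2.1)) (by fun_prop) hmaps)
    continuousOn_const ?_ ?_ ?_ t₁ x₁ () ⟨⟨ht₁.1, le_rfl⟩, hx₁, trivial⟩ (by linarith) one_pos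
  · rintro t x y ⟨h1, h2, h3⟩ hf hg
    obtain ⟨ht, hx⟩ := hint t x h1 h2 hf
    refine ⟨?_, Eventually.of_forall fun y' => ⟨h1, h2, trivial⟩, ?_⟩
    · filter_upwards [(continuous_norm.tendsto x).eventually (gt_mem_nhds hx)] with x' hx'
      exact ⟨h1, by simpa using hx'.le, trivial⟩
    · filter_upwards [Ioo_mem_nhdsLT ht] with s hs
      exact ⟨⟨hs.1.le, hs.2.le.trans h1.2⟩, h2, trivial⟩
  · rintro t x y ⟨h1, h2, h3⟩ hf hg
    obtain ⟨ht, hx⟩ := hint t x h1 h2 hf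
    obtain ⟨L, hL, hl⟩ := hsol t ⟨ht, h1.2.trans_lt ht₁.2⟩ x (by simpa using hx)
    refine ⟨_, hL.neg, fun hmax => ?_⟩
    have := hl.neg.nonpos_of_isLocalMax hmax
    linarith [Real.exp_pos (u t x)]
  · intro t x y _ _ _
    exact ⟨0, hasDerivAt_const _ _, fun _ => by simp⟩

/-- A radial solution on the plane, bounded above and bounded at time `t₁`, stays nonnegative up
to time `t₁`: the two points of the maximum principle are compared with a caloric polynomial. -/
theorem nonneg_of_univ {u : ℝ → Euc 2 → ℝ} {t₁ C M : ℝ} (ht₁ : 0 < t₁)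
    (hcont : ContinuousOn (fun p : ℝ × Euc 2 => u p.1 p.2) (Icc 0 t₁ ×ˢ univ))
    (hsol : ∀ t ∈ Ioc 0 t₁, ∀ x, SolvesAt u t x)
    (hrad : ∀ t, RadiallySymmetric (u t))
    (hC : ∀ t ∈ Ioc 0 t₁, ∀ x, u t x ≤ C)
    (hM : ∀ x, |u t₁ x| ≤ M)
    (hic : ∀ x, 0 ≤ u 0 x) : ∀ x, 0 ≤ u t₁ x := by
  intro y₁
  by_contra hneg
  push Not at hneg
  set A : ℝ := ‖y₁‖ ^ 2 + 4 * t₁ with hA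
  have hA0 : 0 ≤ A := by positivity
  set κ : ℝ := -u t₁ y₁ / (A + 1) with hκ
  have hκ0 : 0 < κ := div_pos (by linarith) (by linarith)
  have hκA : κ * A < -u t₁ y₁ := by
    have : κ * (A + 1) = -u t₁ y₁ := by
      rw [hκ]
      field_simp
    linarith
  set D : ℝ := M + Real.exp C * t₁ + 2 with hD
  have hD0 : 0 ≤ D := by
    have h1 := (abs_nonneg _).trans (hM 0)
    have := Real.exp_pos C
    positivity
  set ρ : ℝ := ‖y₁‖ + 1 + D / κ with hρ
  have hDκ : 0 ≤ D / κ := by positivity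
  have hρ1 : 1 ≤ ρ := by linarith [norm_nonneg y₁]
  have hρD : D ≤ κ * ρ ^ 2 := by
    have h1 : D / κ ≤ ρ ^ 2 := by nlinarith [norm_nonneg y₁]
    rw [div_le_iff₀ hκ0] at h1
    linarith
  set x₁ : Euc 2 := EuclideanSpace.single 0 ρ with hx₁
  have hx₁n : ‖x₁‖ = ρ := by
    rw [hx₁, PiLp.norm_single, Real.norm_of_nonneg (by linarith)]
  set P : ℝ := ρ ^ 4 + 16 * t₁ * ρ ^ 2 + 32 * t₁ ^ 2 with hP
  have hP0 : 0 ≤ P := by positivity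
  set ε : ℝ := 1 / (P + 1) with hε
  have hε0 : 0 < ε := by positivity
  have hεP : ε * P ≤ 1 := by
    rw [hε, one_div_mul_eq_div, div_le_one (by linarith)]
    linarith
  set E : ℝ := κ + 4 * κ * t₁ + |C| with hE
  have hE0 : 0 ≤ E := by positivity
  set q : ℝ := max (max 1 (ρ ^ 2)) (E / ε) with hq
  have hq1 : 1 ≤ q := (le_max_left _ _).trans (le_max_left _ _)
  have hqρ : ρ ^ 2 ≤ q := (le_max_right _ _).trans (le_max_left _ _)
  have hqE : E ≤ ε * q := by
    have : E / ε ≤ q := le_max_right _ _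
    rw [div_le_iff₀ hε0] at this
    linarith
  set K : Set (ℝ × Euc 2 × Euc 2) :=
    {p | p.1 ∈ Icc 0 t₁ ∧ ‖p.2.2‖ ≤ ‖p.2.1‖ ∧ ‖p.2.1‖ ^ 2 ≤ q} with hK
  have hle_q : ∀ {r : ℝ}, r ^ 2 ≤ q → r ≤ q := fun {r} h => by nlinarith
  have hKc : IsCompact K := by
    refine ((isCompact_Icc (a := 0) (b := t₁)).prod ((isCompact_closedBall (0 : Euc 2) q).prod
      (isCompact_closedBall (0 : Euc 2) q))).of_isClosed_subset ?_ ?_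
    · have h1 : IsClosed {p : ℝ × Euc 2 × Euc 2 | ‖p.2.2‖ ≤ ‖p.2.1‖} :=
        isClosed_le (by fun_prop) (by fun_prop)
      have h2 : IsClosed {p : ℝ × Euc 2 × Euc 2 | ‖p.2.1‖ ^ 2 ≤ q} :=
        isClosed_le (by fun_prop) (by fun_prop)
      exact (isClosed_Icc.preimage continuous_fst).inter (h1.inter h2)
    · rintro ⟨t, x, y⟩ ⟨h1, h2, h3⟩
      exact ⟨h1, by simpa using hle_q h3, by simpa using h2.trans (hle_q h3)⟩
  have hmaps₁ : MapsTo (fun p : ℝ × Euc 2 × Euc 2 => (p.1, p.2.1)) K (Icc 0 t₁ ×ˢ univ) :=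
    fun p hp => ⟨hp.1, trivial⟩
  have hmaps₂ : MapsTo (fun p : ℝ × Euc 2 × Euc 2 => (p.1, p.2.2)) K (Icc 0 t₁ ×ˢ univ) :=
    fun p hp => ⟨hp.1, trivial⟩
  set b : ℝ → ℝ → ℝ := fun t ξ => κ * (ξ + 4 * t) with hb
  set Φ : ℝ → ℝ → ℝ := fun t ξ =>
    κ * (ξ + 4 * t) - ε * (ξ ^ 2 + 16 * t * ξ + 32 * t ^ 2) - Real.exp C * t with hΦ
  have hint : ∀ t x y, (t, x, y) ∈ K → 0 < Φ t (‖x‖ ^ 2) - -u t x →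
      0 < -u t y - b t (‖y‖ ^ 2) → 0 < t ∧ ‖y‖ < ‖x‖ ∧ ‖x‖ ^ 2 < q := by
    rintro t x y ⟨h1, h2, h3⟩ hf hg
    dsimp only [hΦ, hb] at h1 h2 h3 hf hg
    have ht : 0 < t := by
      refine lt_of_le_of_ne h1.1 ?_
      rintro rfl
      have h4 := hic y
      have h5 : 0 ≤ κ * ‖y‖ ^ 2 := by positivity
      linarith
    have hpos : 0 ≤ Real.exp C * t := mul_nonneg (Real.exp_pos C).le ht.le
    refine ⟨ht, lt_of_le_of_ne h2 fun h => ?_, lt_of_le_of_ne h3 fun h => ?_⟩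
    · rw [hrad t y x h, h] at hg
      have : 0 ≤ ε * ((‖x‖ ^ 2) ^ 2 + 16 * t * ‖x‖ ^ 2 + 32 * t ^ 2) := by positivity
      linarith
    · rw [h] at hf
      have h4 := hC t ⟨ht, h1.2⟩ x
      have h5 : 0 ≤ ε * (16 * t * q + 32 * t ^ 2) := by positivity
      have h6 : κ * (q + 4 * t) + C ≤ E * q := by
        have h7 := le_abs_self C
        have h8 : κ * t ≤ κ * t₁ := mul_le_mul_of_nonneg_left h1.2 hκ0.le
        have h9 : 0 ≤ (4 * κ * t₁ + |C|) * (q - 1) :=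
          mul_nonneg (by positivity) (by linarith)
        rw [hE]
        linarith
      have h7 : E * q ≤ ε * q * q := mul_le_mul_of_nonneg_right hqE (by linarith)
      linarith
  have hbc : Continuous fun p : ℝ × Euc 2 => b p.1 (‖p.2‖ ^ 2) := by
    simp only [hb]
    fun_prop
  have hΦc : Continuous fun p : ℝ × Euc 2 => Φ p.1 (‖p.2‖ ^ 2) := by
    simp only [hΦ]
    fun_prop
  refine not_pos_of_two_point K hKc (fun t x => Φ t (‖x‖ ^ 2) - -u t x)
    (fun t y => -u t y - b t (‖y‖ ^ 2)) 0
    ((hΦc.continuousOn.sub hcont.neg).comp (f := fun p : ℝ × Euc 2 × Euc 2 => (p.1, p.2.1))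
      (by fun_prop) hmaps₁)
    ((hcont.neg.sub hbc.continuousOn).comp (f := fun p : ℝ × Euc 2 × Euc 2 => (p.1, p.2.2))
      (by fun_prop) hmaps₂)
    ?_ ?_ ?_ t₁ x₁ y₁ ⟨⟨ht₁.le, le_rfl⟩, ?_, ?_⟩ ?_ ?_
  · rintro t x y hp hf hg
    obtain ⟨ht, hyx, hx⟩ := hint t x y hp hf hg
    obtain ⟨h1, h2, h3⟩ := hp
    dsimp only at h1 h2 h3
    refine ⟨?_, ?_, ?_⟩
    · have hc : Continuous fun x : Euc 2 => ‖x‖ ^ 2 := by fun_prop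
      filter_upwards [(continuous_norm.tendsto x).eventually (lt_mem_nhds hyx),
        (hc.tendsto x).eventually (gt_mem_nhds hx)] with x' hx' hx''
      exact ⟨h1, hx'.le, hx''.le⟩
    · filter_upwards [(continuous_norm.tendsto y).eventually (gt_mem_nhds hyx)] with y' hy'
      exact ⟨h1, hy'.le, h3⟩
    · filter_upwards [Ioo_mem_nhdsLT ht] with s hs
      exact ⟨⟨hs.1.le, hs.2.le.trans h1.2⟩, h2, h3⟩
  · rintro t x y hp hf hg
    obtain ⟨ht, -, -⟩ := hint t x y hp hf hg
    obtain ⟨L, hL, hl⟩ := hsol t ⟨ht, hp.1.2⟩ x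
    have hd : HasDerivAt (fun s => Φ s (‖x‖ ^ 2))
        (4 * κ - ε * (16 * ‖x‖ ^ 2 + 64 * t) - Real.exp C) t := by
      have h1 := (((hasDerivAt_id t).const_mul 4).const_add (‖x‖ ^ 2)).const_mul κ
      have h2 := (((((hasDerivAt_id t).const_mul 16).mul_const (‖x‖ ^ 2)).const_add
        ((‖x‖ ^ 2) ^ 2)).add (((hasDerivAt_id t).pow 2).const_mul 32)).const_mul ε
      have h3 := (hasDerivAt_id t).const_mul (Real.exp C)
      refine ((h1.sub h2).sub h3).congr_deriv ?_
      simp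
      ring
    have hlap := hasLap_radial (x := x) (Φ := Φ t) (Φ' := fun ξ => κ - ε * (2 * ξ + 16 * t))
      (a := -(ε * 2)) (fun ξ => by
        have h1 := ((hasDerivAt_id ξ).add_const (4 * t)).const_mul κ
        have h2 := ((((hasDerivAt_id ξ).pow 2).add
          ((hasDerivAt_id ξ).const_mul (16 * t))).add_const (32 * t ^ 2)).const_mul ε
        refine ((h1.sub h2).sub_const (Real.exp C * t)).congr_deriv ?_
        simp) (by fun_prop) (fun _ => by
        have h1 := ((((hasDerivAt_id (‖x‖ ^ 2)).const_mul 2).add_const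
          (16 * t)).const_mul ε).const_sub κ
        exact h1.congr_deriv (by simp))
    refine ⟨_, hd.sub hL.neg, fun hmax => ?_⟩
    have h1 := (hlap.sub hl.neg).nonpos_of_isLocalMax hmax
    have h2 := Real.exp_le_exp.2 (hC t ⟨ht, hp.1.2⟩ x)
    push_cast at h1
    linarith
  · rintro t x y hp hf hg
    obtain ⟨ht, -, -⟩ := hint t x y hp hf hg
    obtain ⟨L, hL, hl⟩ := hsol t ⟨ht, hp.1.2⟩ y
    have hd : HasDerivAt (fun s => b s (‖y‖ ^ 2)) (4 * κ) t := by
      refine ((((hasDerivAt_id t).const_mul 4).const_add (‖y‖ ^ 2)).const_mul κ).congr_deriv ?_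
      ring
    have hlap := hasLap_radial (x := y) (Φ := b t) (Φ' := fun _ => κ) (a := 0)
      (fun ξ => by
        exact (((hasDerivAt_id ξ).add_const (4 * t)).const_mul κ).congr_deriv (by simp))
      continuous_const (fun _ => hasDerivAt_const _ _)
    refine ⟨_, hL.neg.sub hd, fun hmax => ?_⟩
    have h1 := (hl.neg.sub hlap).nonpos_of_isLocalMax hmax
    push_cast at h1
    linarith [Real.exp_pos (u t y)]
  · rw [hx₁n]
    linarith
  · rw [hx₁n]
    exact hqρ
  · have h1 := (abs_le.1 (hM x₁)).1
    have h2 : (ρ ^ 2) ^ 2 + 16 * t₁ * ρ ^ 2 + 32 * t₁ ^ 2 = P := by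
      rw [hP]
      ring
    simp only [hΦ]
    rw [hx₁n, h2]
    have h3 : 0 < κ * t₁ := by positivity
    linarith
  · simp only [hb]
    linarith

theorem IsClassicalSol.contDiffAt {N : ℕ} {Ω : Set (Euc N)} {u : ℝ → Euc N → ℝ}
    {u₀ : Euc N → ℝ} {I : Set ℝ} (h : IsClassicalSol Ω u u₀ I) (hΩ : IsOpen Ω) {t : ℝ}
    (ht : t ∈ I) (h0 : 0 < t) {x : Euc N} (hx : x ∈ Ω) : ContDiffAt ℝ 2 (u t) x :=
  (h.space_reg t ht h0).contDiffAt (hΩ.mem_nhds hx)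

theorem IsClassicalSol.solvesAt {N : ℕ} {Ω : Set (Euc N)} {u : ℝ → Euc N → ℝ}
    {u₀ : Euc N → ℝ} {I : Set ℝ} (h : IsClassicalSol Ω u u₀ I) (hΩ : IsOpen Ω) {t : ℝ}
    (ht : t ∈ I) (h0 : 0 < t) {x : Euc N} (hx : x ∈ Ω) : SolvesAt u t x :=
  ⟨_, h.eq t ht h0 x hx, hasLap_lap (h.contDiffAt hΩ ht h0 hx)⟩

/-- for `N = 2`, radially symmetric solutions attaining their maximum at the
origin blow up with type I rate (Theorem 5 of the paper). -/
theorem stmt_4 (R T : ℝ) (hT : 0 < T) (Ω : Set (Euc 2))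
    (hΩ : (0 < R ∧ Ω = ball (0:Euc 2) R) ∨ Ω = Set.univ)
    (u : ℝ → Euc 2 → ℝ) (u₀ : Euc 2 → ℝ)
    (hu₀C1 : ContDiffOn ℝ 1 u₀ (closure Ω))
    (hu₀pos : ∀ x ∈ closure Ω, 0 ≤ u₀ x)
    (hsol : IsClassicalSol Ω u u₀ (Set.Ico 0 T))
    (hrad : ∀ t, RadiallySymmetric (u t))
    (hmax : ∀ t ∈ Set.Ioo (0:ℝ) T, ∀ x ∈ Ω, u t x ≤ u t 0)
    (hbu : BlowsUpAt Ω u T) :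
    TypeIRate Ω u T := by
  have hopen : IsOpen Ω := by
    rcases hΩ with ⟨-, rfl⟩ | rfl
    exacts [isOpen_ball, isOpen_univ]
  have h0Ω : (0 : Euc 2) ∈ Ω := by
    rcases hΩ with ⟨hR, rfl⟩ | rfl
    exacts [mem_ball_self hR, mem_univ _]
  have hsolves : ∀ t ∈ Ioo 0 T, ∀ x ∈ Ω, SolvesAt u t x := fun t ht x hx =>
    hsol.solvesAt hopen ⟨ht.1.le, ht.2⟩ ht.1 hx
  have hcont : ContinuousOn (fun p : ℝ × Euc 2 => u p.1 p.2) (Ico 0 T ×ˢ Ω) :=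
    hsol.cont.mono (prod_mono Subset.rfl subset_closure)
  have hbound : ∀ t ∈ Ioo 0 T, ∃ M, ∀ x ∈ Ω, |u t x| ≤ M := fun t ht =>
    ⟨(supAbs Ω (u t)).toReal, fun x hx =>
      (ENNReal.ofReal_le_iff_le_toReal (hbu.2.1 t ht).ne).1
        (le_iSup₂ (f := fun x (_ : x ∈ Ω) => ENNReal.ofReal |u t x|) x hx)⟩
  have hnonneg : ∀ t ∈ Ioo 0 T, ∀ x ∈ Ω, 0 ≤ u t x := by
    intro t ht x hx
    have hic : ∀ x ∈ closure Ω, 0 ≤ u 0 x := fun x hx => by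
      rw [hsol.ic x hx]
      exact hu₀pos x hx
    rcases hΩ with ⟨hR, rfl⟩ | rfl
    · have hcl : closure (ball (0 : Euc 2) R) = closedBall 0 R := closure_ball _ hR.ne'
      rw [hcl] at hic
      refine nonneg_of_ball (hcl ▸ hsol.cont) hsolves (fun s hs y hy => hsol.bc s hs y ?_) hic t
        ⟨ht.1.le, ht.2⟩ x (ball_subset_closedBall hx)
      rw [frontier_ball _ hR.ne']
      simpa using hy
    · obtain ⟨M, hM⟩ := hbound t ht
      obtain ⟨C, hC⟩ : BddAbove ((fun s => u s 0) '' Icc 0 t) := by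
        refine (isCompact_Icc.image_of_continuousOn ?_).bddAbove
        exact hcont.comp (f := fun s : ℝ => (s, (0 : Euc 2))) (by fun_prop)
          (fun s hs => ⟨⟨hs.1, hs.2.trans_lt ht.2⟩, trivial⟩)
      exact nonneg_of_univ ht.1
        (hcont.mono (prod_mono (fun s hs => ⟨hs.1, hs.2.trans_lt ht.2⟩) Subset.rfl))
        (fun s hs y => hsolves s ⟨hs.1, hs.2.trans_lt ht.2⟩ y trivial) hrad
        (fun s hs y => (hmax s ⟨hs.1, hs.2.trans_lt ht.2⟩ y trivial).trans
          (hC (mem_image_of_mem _ ⟨hs.1.le, hs.2⟩)))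
        (fun y => hM y trivial) (fun y => hic y (subset_closure trivial)) x
  have hsup : ∀ t ∈ Ioo 0 T, supAbs Ω (u t) = ENNReal.ofReal (u t 0) := fun t ht =>
    supAbs_eq_ofReal h0Ω (hmax t ht) (hnonneg t ht)
  have hblow : ∀ M : ℝ, ∃ᶠ t in 𝓝[<] T, M < u t 0 := by
    intro M
    have h1 : ENNReal.ofReal M < limsup (fun t => supAbs Ω (u t)) (𝓝[<] T) := by
      rw [hbu.2.2]
      exact ENNReal.ofReal_lt_top
    refine ((frequently_lt_of_lt_limsup (by isBoundedDefault) h1).and_eventually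
      (Ioo_mem_nhdsLT hT)).mono ?_
    rintro t ⟨h2, h3⟩
    rw [hsup t h3] at h2
    exact (ENNReal.ofReal_lt_ofReal_iff'.1 h2).1
  obtain ⟨C, hC⟩ := exists_log_add_center_le hT hopen h0Ω hcont
    (fun t ht => (hsol.contDiffAt hopen ⟨ht.1.le, ht.2⟩ ht.1 h0Ω).of_le (by norm_num))
    hsolves hrad hmax hnonneg
  refine ⟨0, C, fun t ht => ?_⟩
  rw [hsup t ht, ENNReal.toReal_ofReal (hnonneg t ht 0 h0Ω)]
  exact ⟨zero_le_log_add_center hopen h0Ω hsolves hmax hblow t ht, hC t ht⟩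

end ExpBlowup
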